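/- arXiv:0908.4327 — 3 statements merged into one kernel-verified Lean document; each statement's English description precedes it below -/
import Mathlib

section
/- There exists a constant K₄ > 0, depending only on n, such that for every tensor H as in the context, every ε > 0, every smooth vector field V on ℝ^n_+, and every δ ≥ 2ε: Σ_{2 ≤ |α| ≤ d} Σ_{i,k=1}^n |h_{ik,α}|² ε^{n−2} ∫_{B_δ(0) ∩ ℝ^n_+} (ε + |x|)^{2|α|+2−2n} dx ≤ K₄ ∫_{B_δ(0) ∩ ℝ^n_+} Σ_{i,k,l=1}^n |Q_{ik,l}(x)|² dx. -/
noncomputable section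

open MeasureTheory Metric

/-- Euclidean space `ℝ^n`. -/
abbrev Euc (n : ℕ) := EuclideanSpace ℝ (Fin n)

/-- Partial derivative in the `i`-th coordinate direction. -/
def pd {n : ℕ} (i : Fin n) (f : Euc n → ℝ) : Euc n → ℝ :=
  fun x => fderiv ℝ f x (EuclideanSpace.single i 1)

/-- Kronecker delta. -/
def kd {n : ℕ} (i k : Fin n) : ℝ := if i = k then 1 else 0

/-- The finite set of multi-indices `α` with `2 ≤ |α| ≤ d`. -/
def MIdx (n d : ℕ) : Finset (Fin n → ℕ) :=
  (Fintype.piFinset fun _ : Fin n => Finset.range (d + 1)).filter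
    fun α => 2 ≤ ∑ i, α i ∧ ∑ i, α i ≤ d

/-- The standard bubble `u_ε(x) = (ε/(ε² + |x|²))^{(n-2)/2}`. -/
def uE (n : ℕ) (ε : ℝ) : Euc n → ℝ :=
  fun x => (ε / (ε ^ 2 + ‖x‖ ^ 2)) ^ (((n : ℝ) - 2) / 2)

/-- `S_{ik} = ∂_i V_k + ∂_k V_i - (2/n) (div V) δ_{ik}`. -/
def Sop {n : ℕ} (V : Fin n → Euc n → ℝ) (i k : Fin n) : Euc n → ℝ :=
  fun x => pd i (V k) x + pd k (V i) x - (2 / (n : ℝ)) * (∑ m, pd m (V m) x) * kd i k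

/-- `T_{ik} = H_{ik} - S_{ik}`. -/
def Tten {n : ℕ} (H : Fin n → Fin n → Euc n → ℝ) (V : Fin n → Euc n → ℝ) (i k : Fin n) :
    Euc n → ℝ :=
  fun x => H i k x - Sop V i k x

/-- The tensor `Q_{ik,l}`. -/
def Qop {n : ℕ} (ε : ℝ) (H : Fin n → Fin n → Euc n → ℝ) (V : Fin n → Euc n → ℝ)
    (i k l : Fin n) : Euc n → ℝ :=
  fun x =>
    uE n ε x * pd l (Tten H V i k) x
      - (2 / ((n : ℝ) - 2)) * pd i (uE n ε) x * Tten H V k l x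
      - (2 / ((n : ℝ) - 2)) * pd k (uE n ε) x * Tten H V i l x
      + (2 / ((n : ℝ) - 2)) * (∑ p, pd p (uE n ε) x * Tten H V i p x) * kd k l
      + (2 / ((n : ℝ) - 2)) * (∑ p, pd p (uE n ε) x * Tten H V k p x) * kd i l

/-- The function `w = Σ_l ∂_l u_ε V_l + ((n-2)/(2n)) u_ε div V`. -/
def wop {n : ℕ} (ε : ℝ) (V : Fin n → Euc n → ℝ) : Euc n → ℝ :=
  fun x => (∑ l, pd l (uE n ε) x * V l x)
    + (((n : ℝ) - 2) / (2 * (n : ℝ))) * uE n ε x * (∑ l, pd l (V l) x)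

set_option linter.unusedSectionVars false
set_option linter.unusedSimpArgs false

namespace Alg
open MvPolynomial
variable {σ : Type} [Fintype σ] [DecidableEq σ]

lemma pcomm (i j : σ) (p : MvPolynomial σ ℝ) :
    pderiv i (pderiv j p) = pderiv j (pderiv i p) := by
  ext m
  simp only [coeff_pderiv]
  by_cases h : i = j
  · subst h; rfl
  · have h' : j ≠ i := fun e => h e.symm
    rw [add_right_comm]
    simp [Finsupp.single_apply, h, h']
    ring

/-- Kronecker delta with values in polynomials. -/
def dl (i j : σ) : MvPolynomial σ ℝ := if i = j then 1 else 0

lemma pX (i j : σ) : pderiv i (X j : MvPolynomial σ ℝ) = dl i j := by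
  rw [pderiv_X]; simp only [dl, Pi.single_apply]
  by_cases h : i = j <;> simp [h, eq_comm]

lemma lap_mul (ψ : MvPolynomial σ ℝ) :
    ∑ i, pderiv i (pderiv i ((∑ j, X j * X j) * ψ)) =
      2 * (Fintype.card σ : MvPolynomial σ ℝ) * ψ + 4 * ∑ i, X i * pderiv i ψ
        + (∑ j, X j * X j) * ∑ i, pderiv i (pderiv i ψ) := by
  have h1 : ∀ i : σ, pderiv i (∑ j, X j * X j : MvPolynomial σ ℝ) = 2 * X i := by
    intro i
    simp only [map_sum, pderiv_mul, pX, dl]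
    simp [Finset.sum_add_distrib]
    ring
  have h2 : ∀ i : σ, pderiv i (pderiv i ((∑ j, X j * X j) * ψ)) =
      2 * ψ + 4 * (X i * pderiv i ψ) + (∑ j, X j * X j) * pderiv i (pderiv i ψ) := by
    intro i
    have h3 : pderiv i (2 * X i : MvPolynomial σ ℝ) = 2 := by
      have : (2 : MvPolynomial σ ℝ) = C 2 := rfl
      rw [this, pderiv_C_mul, pderiv_X_self, mul_one]
    rw [pderiv_mul, h1, map_add, pderiv_mul (f := 2 * X i), h3, pderiv_mul, h1]
    ring
  simp only [h2, Finset.sum_add_distrib, ← Finset.mul_sum]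
  simp
  ring

lemma harm : ∀ (N : ℕ) (φ : MvPolynomial σ ℝ) (c : ℝ), 0 < c → φ.IsHomogeneous N →
    (∑ j, X j * X j) * ∑ i, pderiv i (pderiv i φ) = - (C c * φ) → φ = 0 := by
  intro N
  induction N using Nat.strong_induction_on with
  | _ N ih =>
    intro φ c hc hφ h
    have key : ∑ i, pderiv i (pderiv i φ) = 0 := by
      rcases Nat.eq_zero_or_pos N with h0 | h0
      · subst h0
        have : φ = C (coeff 0 φ) := by
          rw [← homogeneousComponent_zero, homogeneousComponent_eq_self hφ]
        rw [this]; simp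
      · set ψ := ∑ i, pderiv i (pderiv i φ) with hψ
        have hom : ψ.IsHomogeneous (N - 1 - 1) := by
          apply IsHomogeneous.sum; intro i _; exact hφ.pderiv.pderiv
        refine ih (N - 1 - 1) (by omega) ψ
          (c + (2 * Fintype.card σ + 4 * (N - 1 - 1 : ℕ))) (by positivity) hom ?_
        have e := lap_mul ψ
        rw [h, hom.sum_X_mul_pderiv] at e
        simp only [map_neg, pderiv_C_mul, Finset.sum_neg_distrib, ← Finset.mul_sum, ← hψ] at e
        have c1 : (C (c + (2 * Fintype.card σ + 4 * (N - 1 - 1 : ℕ))) : MvPolynomial σ ℝ)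
          = C c + (2 * (Fintype.card σ : MvPolynomial σ ℝ) + 4 * (((N - 1 - 1 : ℕ)) : MvPolynomial σ ℝ)) := by
          simp only [map_add, map_mul, map_natCast, map_ofNat]
        rw [c1, nsmul_eq_mul] at *
        linear_combination -e
    rw [key, mul_zero] at h
    have : C c * φ = 0 := by rw [← neg_eq_zero, ← h]
    rcases mul_eq_zero.mp this with h1 | h1
    · rw [C_eq_zero] at h1; exact absurd h1 hc.ne'
    · exact h1

lemma pick (hc : 4 ≤ Fintype.card σ) (s : Finset σ) (hs : s.card ≤ 3) : ∃ a, a ∉ s := by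
  by_contra hcon
  push Not at hcon
  have : s = Finset.univ := Finset.eq_univ_iff_forall.mpr hcon
  rw [this, Finset.card_univ] at hs
  omega

lemma pick2 (hc : 4 ≤ Fintype.card σ) (a b : σ) : ∃ x, x ≠ a ∧ x ≠ b := by
  obtain ⟨x, hx⟩ := pick hc {a, b} (Finset.card_le_two.trans (by norm_num))
  exact ⟨x, by simpa [not_or] using hx⟩

lemma pick3 (hc : 4 ≤ Fintype.card σ) (a b c : σ) : ∃ x, x ≠ a ∧ x ≠ b ∧ x ≠ c := by
  obtain ⟨x, hx⟩ := pick hc {a, b, c} Finset.card_le_three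
  exact ⟨x, by simpa [not_or] using hx⟩

/-- the Kulkarni-Nomizu product with delta -/
def KN {τ R : Type} [DecidableEq τ] [CommRing R] (A : τ → τ → R) (i j k l : τ) : R :=
  A i k * (if j = l then 1 else 0) + A j l * (if i = k then 1 else 0)
    - A i l * (if j = k then 1 else 0) - A j k * (if i = l then 1 else 0)

lemma kn_exists (hc : 4 ≤ Fintype.card σ) (D : ℕ) (r : σ → σ → σ → σ → MvPolynomial σ ℝ)
    (a1 : ∀ i j k l, r i j k l = - r j i k l) (a2 : ∀ i j k l, r i j k l = - r i j l k)
    (pr : ∀ i j k l, r i j k l = r k l i j)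
    (hom : ∀ i j k l, (r i j k l).IsHomogeneous D)
    (W1 : ∀ i j k l, i ≠ j → i ≠ k → i ≠ l → j ≠ k → j ≠ l → k ≠ l → r i j k l = 0)
    (W2 : ∀ i j k l, i ≠ j → i ≠ k → i ≠ l → j ≠ k → j ≠ l → k ≠ l →
      r i k j k - r i l j l = 0)
    (W3 : ∀ i j k l, i ≠ j → i ≠ k → i ≠ l → j ≠ k → j ≠ l → k ≠ l →
      r i j i j - r j k j k + r k l k l - r l i l i = 0) :
    ∃ A : σ → σ → MvPolynomial σ ℝ, (∀ i k, A i k = A k i) ∧ (∀ i k, (A i k).IsHomogeneous D) ∧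
      ∀ i j k l, r i j k l = KN A i j k l := by
  have hh : (C (1/2 : ℝ) : MvPolynomial σ ℝ) * 2 = 1 := by
    have : (2 : MvPolynomial σ ℝ) = C 2 := rfl
    rw [this, ← C_mul]; norm_num
  choose κ hκ1 hκ2 using pick2 hc
  set a : σ → σ := fun i => κ i i with ha
  have ha' : ∀ i, a i ≠ i := fun i => hκ1 i i
  set b : σ → σ := fun i => κ i (a i) with hb
  have hb1 : ∀ i, b i ≠ i := fun i => hκ1 i _
  have hb2 : ∀ i, b i ≠ a i := fun i => hκ2 i _
  have sw : ∀ i j, r i j i j = r j i j i := by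
    intro i j; rw [a1, a2]; ring
  -- off-diagonal independence
  have od : ∀ i j k l, i ≠ j → k ≠ i → k ≠ j → l ≠ i → l ≠ j → r i k j k = r i l j l := by
    intro i j k l h1 h2 h3 h4 h5
    by_cases h : k = l
    · rw [h]
    · exact sub_eq_zero.mp (W2 i j k l h1 h2.symm h4.symm h3.symm h5.symm h)
  -- diagonal independence
  set g : σ → σ → σ → MvPolynomial σ ℝ := fun i j k => r i j i j + r i k i k - r j k j k with hg
  have gs : ∀ i j k, g i j k = g i k j := by
    intro i j k; simp only [hg]; rw [sw j k]; ring
  have g1 : ∀ i j k l, i ≠ j → i ≠ k → i ≠ l → j ≠ k → j ≠ l → g i j k = g i j l := by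
    intro i j k l h1 h2 h3 h4 h5
    by_cases h : k = l
    · rw [h]
    have := W3 i k j l h2 h1 h3 h4.symm h h5
    simp only [hg]
    rw [sw k j, sw l i] at this
    linear_combination this
  have g2 : ∀ i j k j' k', i ≠ j → i ≠ k → i ≠ j' → i ≠ k' → j ≠ k → j' ≠ k' →
      g i j k = g i j' k' := by
    intro i j k j' k' h1 h2 h3 h4 h5 h6
    by_cases h : j' = k
    · subst h
      rw [gs i j j', g1 i j' j k' h3 h1 h4 h5.symm h6]
    · rw [gs i j k, g1 i k j j' h2 h1 h3 h5.symm (Ne.symm h), gs, g1 i j' k k' h3 h2 h4 h h6]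
  refine ⟨fun i j => if i = j then C (1/2) * g i (a i) (b i) else r i (κ i j) j (κ i j), ?_, ?_, ?_⟩
  · intro i k
    by_cases h : i = k
    · subst h; rfl
    · simp only [h, Ne.symm h, if_false, if_neg (Ne.symm h)]
      rw [pr, od k i (κ i k) (κ k i) (Ne.symm h) (hκ2 _ _) (hκ1 _ _) (hκ1 _ _) (hκ2 _ _)]
  · intro i k
    dsimp only
    split_ifs
    · have := (isHomogeneous_C σ (1/2 : ℝ)).mul
        (((hom i (a i) i (a i)).add (hom i (b i) i (b i))).sub (hom (a i) (b i) (a i) (b i)))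
      simpa using this
    · exact hom _ _ _ _
  · have odA : ∀ i j k, i ≠ k → j ≠ i → j ≠ k → r i j k j = r i (κ i k) k (κ i k) := by
      intro i j k h1 h2 h3
      exact od i k _ _ h1 h2 h3 (hκ1 _ _) (hκ2 _ _)
    have dA : ∀ i j, i ≠ j → r i j i j = C (1/2) * g i (a i) (b i) + C (1/2) * g j (a j) (b j) := by
      intro i j h
      obtain ⟨k, h1, h2⟩ := pick2 hc i j
      rw [g2 i (a i) (b i) j k (ha' i).symm (hb1 i).symm h h1.symm (hb2 i).symm h2.symm,
        g2 j (a j) (b j) i k (ha' j).symm (hb1 j).symm h.symm h2.symm (hb2 j).symm h1.symm]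
      simp only [hg]
      rw [sw j i]
      linear_combination (-r i j i j) * hh
    intro i j k l
    simp only [KN]
    by_cases hij : i = j
    · subst hij
      have : r i i k l = 0 := self_eq_neg.mp (a1 i i k l)
      rw [this]; ring
    by_cases hkl : k = l
    · subst hkl
      have : r i j k k = 0 := self_eq_neg.mp (a2 i j k k)
      rw [this]; ring
    by_cases hik : i = k
    · subst hik
      by_cases hjl : j = l
      · subst hjl
        simp only [hij, Ne.symm hij, if_true, if_false, dA i j hij]
        simp [Ne.symm hij]
      · have h := odA j i l hjl hij hkl
        have : r i j i l = r j i l i := by rw [a1, a2]; ring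
        rw [this, h]
        simp [hjl, hkl, Ne.symm hij]
    by_cases hjl : j = l
    · subst hjl
      rw [odA i j k hik (Ne.symm hij) (Ne.symm hkl)]
      simp [hik, hij, Ne.symm hkl]
    by_cases hil : i = l
    · subst hil
      by_cases hjk : j = k
      · subst hjk
        rw [a2, dA i j hij]
        simp [hij, hkl]
        ring
      · have h := odA j i k hjk hij hik
        rw [a1, h]
        simp [hjk, hij, hik, hjl]
    by_cases hjk : j = k
    · subst hjk
      rw [a2, odA i j l hil (Ne.symm hij) hjl]
      simp [hil, hij, hjl]
    rw [W1 i j k l hij hik hil hjk hjl hkl]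
    simp [hik, hil, hjl, hjk]

end Alg

set_option linter.unusedSectionVars false
set_option linter.unusedSimpArgs false

namespace Alg
open MvPolynomial
variable {σ : Type} [Fintype σ] [DecidableEq σ]

/-- twice the linearised curvature -/
def rel (H : σ → σ → MvPolynomial σ ℝ) (i j k l : σ) : MvPolynomial σ ℝ :=
  pderiv j (pderiv k (H i l)) + pderiv i (pderiv l (H j k))
    - pderiv i (pderiv k (H j l)) - pderiv j (pderiv l (H i k))

/-- vanishing of the linearised Weyl tensor -/
def WF {τ R : Type} [AddCommGroup R] (r : τ → τ → τ → τ → R) : Prop :=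
  (∀ i j k l, i ≠ j → i ≠ k → i ≠ l → j ≠ k → j ≠ l → k ≠ l → r i j k l = 0) ∧
  (∀ i j k l, i ≠ j → i ≠ k → i ≠ l → j ≠ k → j ≠ l → k ≠ l → r i k j k - r i l j l = 0) ∧
  (∀ i j k l, i ≠ j → i ≠ k → i ≠ l → j ≠ k → j ≠ l → k ≠ l →
      r i j i j - r j k j k + r k l k l - r l i l i = 0)

lemma contract (N : ℕ) (H : σ → σ → MvPolynomial σ ℝ)
    (hs : ∀ i k, H i k = H k i) (hom : ∀ i k, (H i k).IsHomogeneous N)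
    (hx : ∀ i, ∑ k, H i k * X k = 0) (i k : σ) :
    ∑ j, ∑ l, X j * X l * rel H i j k l = - ((N : MvPolynomial σ ℝ) * (N + 1)) * H i k := by
  have E0 : ∀ i k, ∑ j, X j * pderiv j (H i k) = (N : MvPolynomial σ ℝ) * H i k := by
    intro i k; rw [(hom i k).sum_X_mul_pderiv, nsmul_eq_mul]
  have G1 : ∀ i k, ∑ l, X l * pderiv k (H i l) = - H i k := by
    intro i k
    have := congrArg (pderiv k) (hx i)
    simp only [map_sum, pderiv_mul, pX, map_zero, Finset.sum_add_distrib, dl] at this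
    simp at this
    rw [eq_neg_iff_add_eq_zero, ← this]
    simp only [mul_comm]
  have G2 : ∀ i j k, ∑ l, X l * pderiv j (pderiv k (H i l))
      = - pderiv j (H i k) - pderiv k (H i j) := by
    intro i j k
    have := congrArg (pderiv j) (G1 i k)
    simp only [map_sum, pderiv_mul, pX, map_neg, Finset.sum_add_distrib, dl] at this
    simp at this
    linear_combination this
  have E1 : ∀ i k l, ∑ j, X j * pderiv j (pderiv l (H i k))
      = ((N : MvPolynomial σ ℝ) - 1) * pderiv l (H i k) := by
    intro i k l
    have := congrArg (pderiv l) (E0 i k)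
    have hN : (N : MvPolynomial σ ℝ) = C (N : ℝ) := by simp
    simp only [map_sum, pderiv_mul, pX, Finset.sum_add_distrib, dl] at this
    rw [hN, pderiv_C, ← hN] at this
    simp at this
    simp only [pcomm _ l]
    linear_combination this
  have T1 : ∑ j, ∑ l, X j * X l * pderiv j (pderiv k (H i l)) = (1 - (N : MvPolynomial σ ℝ)) * H i k := by
    have : ∀ j, ∑ l, X j * X l * pderiv j (pderiv k (H i l))
        = - (X j * pderiv j (H i k)) - X j * pderiv k (H i j) := by
      intro j
      simp only [mul_assoc, ← Finset.mul_sum, G2]; ring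
    simp only [this, Finset.sum_sub_distrib, Finset.sum_neg_distrib, E0, G1]; ring
  have T2 : ∑ j, ∑ l, X j * X l * pderiv i (pderiv l (H j k)) = (1 - (N : MvPolynomial σ ℝ)) * H i k := by
    rw [Finset.sum_comm]
    have : ∀ l, ∑ j, X j * X l * pderiv i (pderiv l (H j k))
        = - (X l * pderiv l (H k i)) - X l * pderiv i (H k l) := by
      intro l
      have : ∀ j, X j * X l * pderiv i (pderiv l (H j k)) = X l * (X j * pderiv i (pderiv l (H k j))) := by
        intro j; rw [hs j k]; ring
      simp only [this, ← Finset.mul_sum, G2]; ring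
    simp only [this, Finset.sum_sub_distrib, Finset.sum_neg_distrib, E0, G1, hs k i]; ring
  have T3 : ∑ j, ∑ l, X j * X l * pderiv i (pderiv k (H j l)) = 2 * H i k := by
    have : ∀ j, ∑ l, X j * X l * pderiv i (pderiv k (H j l))
        = - (X j * pderiv i (H k j)) - X j * pderiv k (H i j) := by
      intro j
      simp only [mul_assoc, ← Finset.mul_sum, G2, hs j k, hs j i]; ring
    simp only [this, Finset.sum_sub_distrib, Finset.sum_neg_distrib, E0, G1, hs k i]; ring
  have T4 : ∑ j, ∑ l, X j * X l * pderiv j (pderiv l (H i k)) = (N : MvPolynomial σ ℝ) * (N - 1) * H i k := by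
    rw [Finset.sum_comm]
    have : ∀ l, ∑ j, X j * X l * pderiv j (pderiv l (H i k))
        = ((N : MvPolynomial σ ℝ) - 1) * (X l * pderiv l (H i k)) := by
      intro l
      have : ∀ j, X j * X l * pderiv j (pderiv l (H i k)) = X l * (X j * pderiv j (pderiv l (H i k))) := by
        intro j; ring
      simp only [this, ← Finset.mul_sum, E1]; ring
    simp only [this, ← Finset.mul_sum, E0]; ring
  simp only [rel, mul_add, mul_sub, Finset.sum_add_distrib, Finset.sum_sub_distrib, T1, T2, T3, T4]
  ring

lemma codazzi (hc : 4 ≤ Fintype.card σ) (H A : σ → σ → MvPolynomial σ ℝ)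
    (hr : ∀ i j k l, rel H i j k l = KN A i j k l) (p i k : σ) :
    pderiv p (A i k) = pderiv k (A i p) := by
  have bi : ∀ i j k l p, pderiv p (rel H i j k l) + pderiv k (rel H i j l p)
      + pderiv l (rel H i j p k) = 0 := by
    intro i j k l p
    simp only [rel, map_add, map_sub]
    rw [pcomm p j, pcomm p i, pcomm p i, pcomm p j, pcomm k j, pcomm k i, pcomm k i, pcomm k j,
      pcomm l j, pcomm l i, pcomm l i, pcomm l j,
      pcomm p k, pcomm p l, pcomm p k, pcomm p l, pcomm k l, pcomm k l]
    ring
  by_cases hpk : p = k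
  · subst hpk; rfl
  have dis : ∀ p k i, p ≠ k → p ≠ i → k ≠ i → pderiv p (A i k) = pderiv k (A i p) := by
    intro p k i h1 h2 h3
    obtain ⟨j, hj1, hj2, hj3⟩ := pick3 hc p k i
    have := bi i j k j p
    simp only [hr, KN] at this
    simp [h1, h2, h3, h1.symm, h2.symm, h3.symm, hj1, hj2, hj3, hj1.symm, hj2.symm, hj3.symm] at this
    linear_combination this
  have two : ∀ p i, p ≠ i → pderiv p (A i i) = pderiv i (A i p) := by
    intro p i h
    have g : ∀ i j, i ≠ p → j ≠ p → j ≠ i → (pderiv p (A i i) - pderiv i (A i p)) +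
        (pderiv p (A j j) - pderiv j (A j p)) = 0 := by
      intro i j h1 h2 h3
      have := bi i j i j p
      simp only [hr, KN] at this
      simp [h1, h2, h3, h1.symm, h2.symm, h3.symm] at this
      linear_combination this
    obtain ⟨j, hj1, hj2⟩ := pick2 hc p i
    obtain ⟨k, hk1, hk2, hk3⟩ := pick3 hc p i j
    have e1 := g i j h.symm hj1 hj2
    have e2 := g i k h.symm hk1 hk2
    have e3 := g j k hj1 hk1 hk3
    have : (C (2:ℝ)) * (pderiv p (A i i) - pderiv i (A i p)) = 0 := by
      have h2 : (C (2:ℝ) : MvPolynomial σ ℝ) = 2 := rfl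
      rw [h2]
      linear_combination e1 + e2 - e3
    rcases mul_eq_zero.mp this with h | h
    · rw [C_eq_zero] at h; norm_num at h
    · exact sub_eq_zero.mp h
  by_cases hik : i = k
  · subst hik; exact two p i hpk
  by_cases hip : i = p
  · subst hip; rw [two k i (Ne.symm hpk)]
  · exact dis p k i hpk (Ne.symm hip) (Ne.symm hik)

lemma inj_hom (hc : 4 ≤ Fintype.card σ) (N : ℕ) (hN : 2 ≤ N) (H : σ → σ → MvPolynomial σ ℝ)
    (hs : ∀ i k, H i k = H k i) (hom : ∀ i k, (H i k).IsHomogeneous N)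
    (htr : ∑ i, H i i = 0)
    (hx : ∀ i, ∑ k, H i k * X k = 0) (hW : WF (rel H)) : ∀ i k, H i k = 0 := by
  obtain ⟨A, hA, hAh, hr⟩ := kn_exists hc (N - 1 - 1) (rel H)
    (by intro i j k l; simp only [rel]; ring)
    (by intro i j k l; simp only [rel]; ring)
    (by intro i j k l; simp only [rel]
        rw [pcomm l i, hs k j, hs l i, pcomm k j, pcomm k i, hs l j, pcomm l j, hs k i]; ring)
    (by intro i j k l
        exact (((hom _ _).pderiv.pderiv.add (hom _ _).pderiv.pderiv).sub
          (hom _ _).pderiv.pderiv).sub (hom _ _).pderiv.pderiv)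
    hW.1 hW.2.1 hW.2.2
  have cod := codazzi hc H A hr
  obtain ⟨M, rfl⟩ : ∃ M, N = M + 2 := ⟨N - 2, by omega⟩
  simp only [Nat.add_sub_cancel, show M + 2 - 1 - 1 = M by omega] at hAh
  set ax : σ → MvPolynomial σ ℝ := fun i => ∑ k, A i k * X k with hax
  set q : MvPolynomial σ ℝ := ∑ i, ax i * X i with hq
  have EA : ∀ i k, ∑ j, X j * pderiv j (A i k) = (M : MvPolynomial σ ℝ) * A i k := by
    intro i k; rw [(hAh i k).sum_X_mul_pderiv, nsmul_eq_mul]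
  have dax : ∀ i p, pderiv p (ax i) = (M + 1 : MvPolynomial σ ℝ) * A i p := by
    intro i p
    simp only [hax, map_sum, pderiv_mul, pX, Finset.sum_add_distrib, dl]
    simp only [fun k => cod p i k]
    simp only [mul_comm _ (X _), EA]
    simp; ring
  have dq : ∀ p, pderiv p q = (M + 2 : MvPolynomial σ ℝ) * ax p := by
    intro p
    simp only [hq, map_sum, pderiv_mul, pX, Finset.sum_add_distrib, dl, dax]
    simp only [mul_assoc, ← Finset.mul_sum, hA _ p]
    simp [hax]; ring
  have cc : ∀ a : ℕ, ∀ p (f : MvPolynomial σ ℝ), pderiv p ((a : MvPolynomial σ ℝ) * f) = a * pderiv p f := by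
    intro a p f
    have : (a : MvPolynomial σ ℝ) = C (a : ℝ) := by simp
    rw [this, pderiv_C_mul]
  have ddq : ∀ p k, pderiv k (pderiv p q) = ((M + 2) * (M + 1) : MvPolynomial σ ℝ) * A p k := by
    intro p k
    have e : (M + 2 : MvPolynomial σ ℝ) = ((M + 2 : ℕ) : MvPolynomial σ ℝ) := by push_cast; ring
    rw [dq, e, cc, dax]; push_cast; ring
  have con : ∀ i k, A i k * (∑ j, X j * X j) + q * dl i k - ax i * X k - ax k * X i
      = - (((M + 2 : ℕ) : MvPolynomial σ ℝ) * (((M + 2 : ℕ) : MvPolynomial σ ℝ) + 1)) * H i k := by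
    intro i k
    rw [← contract (M + 2) H hs hom hx i k]
    simp only [hr, KN]
    have t1 : ∑ j, ∑ l, X j * X l * (A i k * (if j = l then 1 else 0)) = A i k * (∑ j, X j * X j) := by
      rw [Finset.mul_sum]
      refine Finset.sum_congr rfl fun j _ => ?_
      simp; ring
    have t2 : ∑ j, ∑ l, X j * X l * (A j l * (if i = k then 1 else 0)) = q * dl i k := by
      simp only [hq, hax, dl, Finset.sum_mul]
      refine Finset.sum_congr rfl fun j _ => Finset.sum_congr rfl fun l _ => ?_
      ring
    have t3 : ∑ j, ∑ l, X j * X l * (A i l * (if j = k then 1 else 0)) = ax i * X k := by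
      rw [Finset.sum_comm]
      simp only [hax, Finset.sum_mul]
      refine Finset.sum_congr rfl fun j _ => ?_
      simp; ring
    have t4 : ∑ j, ∑ l, X j * X l * (A j k * (if i = l then 1 else 0)) = ax k * X i := by
      simp only [hax, Finset.sum_mul]
      refine Finset.sum_congr rfl fun j _ => ?_
      simp [hA k j]; ring
    simp only [mul_add, mul_sub, Finset.sum_add_distrib, Finset.sum_sub_distrib]
    rw [t1, t2, t3, t4]
  have tr : (∑ i, A i i) * (∑ j, X j * X j) + (Fintype.card σ : MvPolynomial σ ℝ) * q - 2 * q = 0 := by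
    have : ∑ i, (A i i * (∑ j, X j * X j) + q * dl i i - ax i * X i - ax i * X i) = 0 := by
      simp only [con, ← Finset.mul_sum, htr, mul_zero]
    simp only [Finset.sum_add_distrib, Finset.sum_sub_distrib, ← Finset.sum_mul, ← hq, dl] at this
    simp at this
    linear_combination this
  have qh : q.IsHomogeneous (M + 1 + 1) :=
    IsHomogeneous.sum _ _ _ fun i _ =>
      (IsHomogeneous.sum _ _ _ fun k _ => (hAh i k).mul (isHomogeneous_X ℝ k)).mul (isHomogeneous_X ℝ i)
  have q0 : q = 0 := by
    have h4 : (4 : ℝ) ≤ Fintype.card σ := by exact_mod_cast hc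
    refine harm (M + 1 + 1) q (((Fintype.card σ : ℝ) - 2) * ((M + 2) * (M + 1)))
      (mul_pos (by linarith) (by positivity)) qh ?_
    simp only [ddq, ← Finset.mul_sum]
    simp only [map_mul, map_sub, map_add, map_natCast, map_ofNat, map_one]
    linear_combination ((M + 2) * (M + 1) : MvPolynomial σ ℝ) * tr
  have A0 : ∀ i k, A i k = 0 := by
    intro i k
    have := ddq i k
    rw [q0] at this
    have h0 : ((((M + 2) * (M + 1) : ℕ)) : MvPolynomial σ ℝ) * A i k = 0 := by
      push_cast; rw [← this]; simp
    rcases mul_eq_zero.mp h0 with h | h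
    · rw [Nat.cast_eq_zero] at h; simp at h
    · exact h
  intro i k
  have e := con i k
  have e0 : A i k * (∑ j, X j * X j) + q * dl i k - ax i * X k - ax k * X i = 0 := by
    simp [hax, A0, q0]
  rw [e0] at e
  have h0 : ((((M + 2) * (M + 3) : ℕ)) : MvPolynomial σ ℝ) * H i k = 0 := by
    push_cast at e ⊢
    linear_combination e
  rcases mul_eq_zero.mp h0 with h | h
  · rw [Nat.cast_eq_zero] at h; simp at h
  · exact h

end Alg

set_option linter.unusedSectionVars false
set_option linter.unusedSimpArgs false

namespace Alg
open MvPolynomial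
variable {σ : Type} [Fintype σ] [DecidableEq σ]

lemma hcX (N : ℕ) (p : MvPolynomial σ ℝ) (k : σ) :
    homogeneousComponent (N + 1) (p * X k) = homogeneousComponent N p * X k := by
  ext s
  rw [coeff_homogeneousComponent, coeff_mul_X', coeff_mul_X', coeff_homogeneousComponent]
  by_cases h : k ∈ s.support
  · simp only [h, if_true]
    have hk : Finsupp.single k 1 ≤ s := by
      rw [Finsupp.single_le_iff]
      exact Nat.one_le_iff_ne_zero.mpr (Finsupp.mem_support_iff.mp h)
    have e : s.degree = (s - Finsupp.single k 1).degree + 1 := by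
      conv_lhs => rw [← tsub_add_cancel_of_le hk]
      simp
    rw [e]; simp
  · simp [h]

lemma hcd (N : ℕ) (p : MvPolynomial σ ℝ) (i : σ) :
    pderiv i (homogeneousComponent (N + 1) p) = homogeneousComponent N (pderiv i p) := by
  ext s
  simp only [coeff_pderiv, coeff_homogeneousComponent]
  simp

lemma rel_hc (N : ℕ) (H : σ → σ → MvPolynomial σ ℝ) (i j k l : σ) :
    rel (fun i k => homogeneousComponent (N + 2) (H i k)) i j k l
      = homogeneousComponent N (rel H i j k l) := by
  simp only [rel, hcd, map_add, map_sub]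

lemma inj_bd (hc : 4 ≤ Fintype.card σ) (H : σ → σ → MvPolynomial σ ℝ)
    (hs : ∀ i k, H i k = H k i)
    (hlow : ∀ N < 2, ∀ i k, homogeneousComponent N (H i k) = 0)
    (htr : ∑ i, H i i = 0)
    (hx : ∀ i, ∑ k, H i k * X k = 0) (hW : WF (rel H)) : ∀ i k, H i k = 0 := by
  have key : ∀ N i k, homogeneousComponent N (H i k) = 0 := by
    intro N
    by_cases h2 : N < 2
    · exact hlow N h2
    obtain ⟨M, rfl⟩ : ∃ M, N = M + 2 := ⟨N - 2, by omega⟩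
    apply inj_hom hc (M + 2) (by omega) (fun i k => homogeneousComponent (M + 2) (H i k))
    · intro i k; rw [hs]
    · intro i k; exact homogeneousComponent_isHomogeneous _ _
    · rw [← map_sum, htr, map_zero]
    · intro i
      have := congrArg (homogeneousComponent (M + 2 + 1)) (hx i)
      rw [map_sum, map_zero] at this
      simpa only [hcX] using this
    · refine ⟨?_, ?_, ?_⟩
      · intro i j k l h1 h2 h3 h4 h5 h6
        rw [rel_hc, hW.1 i j k l h1 h2 h3 h4 h5 h6, map_zero]
      · intro i j k l h1 h2 h3 h4 h5 h6
        rw [rel_hc, rel_hc, ← map_sub, hW.2.1 i j k l h1 h2 h3 h4 h5 h6, map_zero]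
      · intro i j k l h1 h2 h3 h4 h5 h6
        rw [rel_hc, rel_hc, rel_hc, rel_hc, ← map_sub, ← map_add, ← map_sub,
          hW.2.2 i j k l h1 h2 h3 h4 h5 h6, map_zero]
  intro i k
  rw [← sum_homogeneousComponent (H i k)]
  exact Finset.sum_eq_zero fun N _ => key N i k

variable {m : ℕ}

/-- restriction to the hyperplane where the last coordinate vanishes -/
def phi (m : ℕ) : MvPolynomial (Fin (m + 1)) ℝ →ₐ[ℝ] MvPolynomial (Fin m) ℝ :=
  aeval (Fin.snoc (α := fun _ => MvPolynomial (Fin m) ℝ) X 0)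

lemma phi_cs (i : Fin m) : phi m (X i.castSucc) = X i := by simp [phi]
lemma phi_last : phi m (X (Fin.last m)) = 0 := by simp [phi]

lemma phi_pd (i : Fin m) (p : MvPolynomial (Fin (m + 1)) ℝ) :
    phi m (pderiv i.castSucc p) = pderiv i (phi m p) := by
  induction p using MvPolynomial.induction_on with
  | C a => 
    rw [pderiv_C, show (C a : MvPolynomial (Fin (m+1)) ℝ) = algebraMap _ _ a from rfl, AlgHom.commutes]
    simp [MvPolynomial.algebraMap_eq]
  | add p q hp hq => simp only [map_add, hp, hq]
  | mul_X p j hp =>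
    rw [pderiv_mul, map_add, map_mul, map_mul, hp, map_mul, pderiv_mul]
    congr 2
    rw [pX]
    refine Fin.lastCases ?_ (fun j => ?_) j
    · rw [phi_last]; simp [dl]
    · rw [phi_cs, pX]; simp only [dl, Fin.castSucc_inj]; split_ifs <;> simp

lemma phi_hc (N : ℕ) (p : MvPolynomial (Fin (m + 1)) ℝ) :
    homogeneousComponent N (phi m p) = phi m (homogeneousComponent N p) := by
  have hh : ∀ j (q : MvPolynomial (Fin (m + 1)) ℝ), q.IsHomogeneous j → (phi m q).IsHomogeneous j := by
    intro j q hq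
    have := hq.aeval (Fin.snoc (α := fun _ => MvPolynomial (Fin m) ℝ) X 0) (n := 1) (by
      intro i
      refine Fin.lastCases ?_ (fun j => ?_) i
      · simp; exact isHomogeneous_zero _ _ _
      · simp; exact isHomogeneous_X _ _)
    simpa [phi] using this
  conv_lhs => rw [← sum_homogeneousComponent p]
  rw [map_sum, map_sum]
  have : ∀ j, homogeneousComponent N (phi m (homogeneousComponent j p))
      = if N = j then phi m (homogeneousComponent j p) else 0 := by
    intro j
    exact homogeneousComponent_of_mem (hh j _ (homogeneousComponent_isHomogeneous _ _))
  simp only [this]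
  rw [Finset.sum_ite_eq]
  split_ifs with h
  · rfl
  · simp at h
    rw [homogeneousComponent_eq_zero _ _ (by omega), map_zero]

/-- restriction to a vertical line -/
def gx (x : Fin m → ℝ) : MvPolynomial (Fin (m + 1)) ℝ →ₐ[ℝ] Polynomial ℝ :=
  aeval (Fin.snoc (α := fun _ => Polynomial ℝ) (fun i => Polynomial.C (x i)) Polynomial.X)

lemma gx_der (x : Fin m → ℝ) (p : MvPolynomial (Fin (m + 1)) ℝ) :
    gx x (pderiv (Fin.last m) p) = Polynomial.derivative (gx x p) := by
  induction p using MvPolynomial.induction_on with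
  | C a => 
    rw [pderiv_C, show (C a : MvPolynomial (Fin (m+1)) ℝ) = algebraMap _ _ a from rfl, AlgHom.commutes]
    simp [Polynomial.algebraMap_eq]
  | add p q hp hq => simp only [map_add, hp, hq]
  | mul_X p j hp =>
    rw [pderiv_mul, map_add, map_mul, map_mul, hp, map_mul, Polynomial.derivative_mul]
    congr 2
    rw [pX]
    refine Fin.lastCases ?_ (fun j => ?_) j
    · simp [dl, gx]
    · have : Fin.last m ≠ j.castSucc := (Fin.castSucc_lt_last j).ne'
      simp [dl, gx, this]

lemma gx_eval (y : Fin (m + 1) → ℝ) (p : MvPolynomial (Fin (m + 1)) ℝ) :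
    Polynomial.eval (y (Fin.last m)) (gx (fun i => y i.castSucc) p) = eval y p := by
  induction p using MvPolynomial.induction_on with
  | C a => 
    rw [show (C a : MvPolynomial (Fin (m+1)) ℝ) = algebraMap _ _ a from rfl, AlgHom.commutes]
    simp [Polynomial.algebraMap_eq, MvPolynomial.algebraMap_eq]
  | add p q hp hq => simp only [map_add, Polynomial.eval_add, hp, hq]
  | mul_X p j hp =>
    rw [map_mul, Polynomial.eval_mul, hp, map_mul]
    congr 1
    refine Fin.lastCases ?_ (fun j => ?_) j
    · simp [gx]
    · simp [gx]

lemma phi_eval (x : Fin m → ℝ) (p : MvPolynomial (Fin (m + 1)) ℝ) :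
    eval x (phi m p) = eval (Fin.snoc (α := fun _ => ℝ) x 0) p := by
  induction p using MvPolynomial.induction_on with
  | C a => 
    rw [show (C a : MvPolynomial (Fin (m+1)) ℝ) = algebraMap _ _ a from rfl, AlgHom.commutes]
    simp [MvPolynomial.algebraMap_eq]
  | add p q hp hq => simp only [map_add, hp, hq]
  | mul_X p j hp =>
    rw [map_mul, map_mul, hp, map_mul]
    congr 1
    refine Fin.lastCases ?_ (fun j => ?_) j
    · simp [phi]
    · simp [phi]

lemma jet_zero (q : MvPolynomial (Fin (m + 1)) ℝ)
    (h : ∀ j, phi m ((pderiv (Fin.last m))^[j] q) = 0) : q = 0 := by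
  apply MvPolynomial.funext
  intro y
  rw [← gx_eval, map_zero]
  set x : Fin m → ℝ := fun i => y i.castSucc
  have it : ∀ j (q : MvPolynomial (Fin (m + 1)) ℝ), gx x ((pderiv (Fin.last m))^[j] q) = Polynomial.derivative^[j] (gx x q) := by
    intro j
    induction j with
    | zero => intro q; rfl
    | succ j ih => intro q; rw [Function.iterate_succ_apply, Function.iterate_succ_apply, ih, gx_der]
  have : gx x q = 0 := by
    ext j
    have h1 := congrArg (eval x) (h j)
    rw [phi_eval, ← gx_eval] at h1
    simp only [Fin.snoc_castSucc, Fin.snoc_last, map_zero] at h1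
    rw [it, ← Polynomial.coeff_zero_eq_eval_zero, Polynomial.coeff_iterate_derivative] at h1
    rw [zero_add, Nat.descFactorial_self, nsmul_eq_mul] at h1
    rcases mul_eq_zero.mp h1 with h1 | h1
    · exact absurd h1 (by exact_mod_cast Nat.factorial_ne_zero j)
    · simpa using h1
  rw [this]; simp

theorem inj_half (hm : 4 ≤ m) (p : Fin (m + 1) → Fin (m + 1) → MvPolynomial (Fin (m + 1)) ℝ)
    (hs : ∀ i k, p i k = p k i) (htr : ∑ i, p i i = 0)
    (hn : ∀ i, p i (Fin.last m) = 0)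
    (hlow : ∀ N < 2, ∀ i k, homogeneousComponent N (p i k) = 0)
    (hx : ∀ i, phi m (∑ k, p i k * X k) = 0)
    (hd : ∀ i k, phi m (pderiv (Fin.last m) (p i k)) = 0)
    (hW : WF (rel p)) : ∀ i k, p i k = 0 := by
  have hn' : ∀ i, p (Fin.last m) i = 0 := fun i => by rw [hs, hn]
  have hc : 4 ≤ Fintype.card (Fin m) := by simpa using hm
  have relphi : ∀ (q : Fin (m + 1) → Fin (m + 1) → MvPolynomial (Fin (m + 1)) ℝ) a b c e,
      phi m (rel q a.castSucc b.castSucc c.castSucc e.castSucc)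
      = rel (fun i k : Fin m => phi m (q i.castSucc k.castSucc)) a b c e := by
    intro q a b c e
    simp only [rel, map_add, map_sub, phi_pd]
  have cs : ∀ {a b : Fin m}, a ≠ b → a.castSucc ≠ b.castSucc := by
    intro a b h e; exact h (Fin.castSucc_injective m e)
  have bd : ∀ i k : Fin m, phi m (p i.castSucc k.castSucc) = 0 := by
    apply inj_bd hc (fun i k : Fin m => phi m (p i.castSucc k.castSucc))
    · intro i k; rw [hs]
    · intro N hN i k; rw [phi_hc, hlow N hN, map_zero]
    · have := congrArg (phi m) htr
      rw [Fin.sum_univ_castSucc, hn, add_zero, map_sum, map_zero] at this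
      exact this
    · intro i
      have := hx i.castSucc
      rw [Fin.sum_univ_castSucc, hn, zero_mul, add_zero, map_sum] at this
      simpa only [map_mul, phi_cs] using this
    · refine ⟨?_, ?_, ?_⟩
      · intro i j k l h1 h2 h3 h4 h5 h6
        rw [← relphi, hW.1 _ _ _ _ (cs h1) (cs h2) (cs h3) (cs h4) (cs h5) (cs h6), map_zero]
      · intro i j k l h1 h2 h3 h4 h5 h6
        rw [← relphi, ← relphi, ← map_sub, hW.2.1 _ _ _ _ (cs h1) (cs h2) (cs h3) (cs h4) (cs h5) (cs h6), map_zero]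
      · intro i j k l h1 h2 h3 h4 h5 h6
        rw [← relphi, ← relphi, ← relphi, ← relphi, ← map_sub, ← map_add, ← map_sub,
          hW.2.2 _ _ _ _ (cs h1) (cs h2) (cs h3) (cs h4) (cs h5) (cs h6), map_zero]
  set D : MvPolynomial (Fin (m + 1)) ℝ → MvPolynomial (Fin (m + 1)) ℝ := ⇑(pderiv (R := ℝ) (Fin.last m)) with hD
  have Dc : ∀ j i q, D^[j] (pderiv i q) = pderiv i (D^[j] q) := by
    intro j i q
    have : Function.Commute D (pderiv i) := fun q => pcomm _ _ _
    exact this.iterate_left j q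
  have Dadd : ∀ j a b, D^[j] (a + b) = D^[j] a + D^[j] b := fun j a b =>
    iterate_map_add (pderiv (Fin.last m)) j a b
  have Dsub : ∀ j a b, D^[j] (a - b) = D^[j] a - D^[j] b := fun j a b =>
    iterate_map_sub (pderiv (Fin.last m)) j a b
  have Dneg : ∀ j a, D^[j] (-a) = - D^[j] a := fun j a =>
    iterate_map_neg (pderiv (Fin.last m)) j a
  have Dsum : ∀ j (f : Fin m → MvPolynomial (Fin (m + 1)) ℝ), D^[j] (∑ a, f a) = ∑ a, D^[j] (f a) := by
    intro j f
    induction j with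
    | zero => rfl
    | succ j ih => simp only [Function.iterate_succ_apply', ih]; simp only [hD, map_sum]
  have D0 : ∀ j, D^[j] 0 = 0 := fun j => iterate_map_zero (pderiv (Fin.last m)) j
  have main : ∀ j, ∀ i k, phi m (D^[j] (p i k)) = 0 := by
    intro j
    induction j using Nat.strong_induction_on with
    | _ j ih =>
      intro i k
      refine Fin.lastCases (by rw [hn', D0, map_zero]) (fun a => ?_) i
      refine Fin.lastCases (by rw [hn, D0, map_zero]) (fun b => ?_) k
      rcases Nat.lt_or_ge j 2 with hj | hj
      · interval_cases j
        · exact bd a b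
        · exact hd _ _
      obtain ⟨J, rfl⟩ : ∃ J, j = J + 2 := ⟨j - 2, by omega⟩
      have r0 : ∀ a b c e : Fin m, phi m (D^[J] (rel p a.castSucc b.castSucc c.castSucc e.castSucc)) = 0 := by
        intro a b c e
        simp only [rel, Dadd, Dsub, Dc, map_add, map_sub, phi_pd, ih J (by omega), map_zero]
        simp
      have ll : ∀ a : Fin m, a.castSucc ≠ Fin.last m := fun a => (Fin.castSucc_lt_last a).ne
      have rn : ∀ a b : Fin m, rel p a.castSucc (Fin.last m) b.castSucc (Fin.last m)
          = - D (D (p a.castSucc b.castSucc)) := by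
        intro a b
        simp only [rel, hn, hn', map_zero, hD]; ring
      have rn' : ∀ a : Fin m, rel p (Fin.last m) a.castSucc (Fin.last m) a.castSucc 
          = - D (D (p a.castSucc a.castSucc)) := by
        intro a
        simp only [rel, hn, hn', map_zero, hD]; ring
      by_cases hab : a = b
      · subst hab
        have e : ∀ c : Fin m, phi m (D^[J + 2] (p a.castSucc a.castSucc)) = phi m (D^[J + 2] (p c.castSucc c.castSucc)) := by
          intro c
          by_cases hac : a = c
          · rw [hac]
          obtain ⟨e, he1, he2⟩ := pick2 hc a c
          have w := hW.2.2 a.castSucc (Fin.last m) c.castSucc e.castSucc (ll a) (cs hac) (cs he1.symm)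
            (ll c).symm (ll e).symm (cs he2.symm)
          rw [rn, rn'] at w
          have w2 := congrArg (fun q => phi m (D^[J] q)) w
          simp only [Dadd, Dsub, Dneg, map_add, map_sub, map_neg, r0, D0, map_zero] at w2
          simp only [Function.iterate_add_apply _ J 2]
          simp only [Function.iterate_succ_apply, Function.iterate_zero_apply]
          linear_combination -w2
        have t := congrArg (fun q => phi m (D^[J + 2] q)) htr
        simp only [Fin.sum_univ_castSucc, hn, add_zero, D0, map_zero, Dsum, map_sum] at t
        simp only [← e] at t
        simp at t
        rcases t with t | t
        · omega
        · exact t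
      · obtain ⟨c, hc1, hc2⟩ := pick2 hc a b
        have w := hW.2.1 a.castSucc b.castSucc (Fin.last m) c.castSucc (cs hab) (ll a) (cs hc1.symm)
            (ll b) (cs hc2.symm) (ll c).symm
        rw [rn] at w
        have w2 := congrArg (fun q => phi m (D^[J] q)) w
        simp only [Dsub, Dneg, map_sub, map_neg, r0, D0, map_zero] at w2
        simp only [Function.iterate_add_apply _ J 2]
        simp only [Function.iterate_succ_apply, Function.iterate_zero_apply]
        linear_combination -w2
  intro i k
  exact jet_zero _ fun j => main j i k

end Alg

open scoped ContDiff

section pdlemmas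
variable {n : ℕ}

lemma sm_da {f : Euc n → ℝ} (hf : ContDiff ℝ ∞ f) (x : Euc n) : DifferentiableAt ℝ f x :=
  (hf.differentiable (by simp)) x

lemma pd_sm {f : Euc n → ℝ} (hf : ContDiff ℝ ∞ f) (i : Fin n) : ContDiff ℝ ∞ (pd i f) := by
  unfold pd
  exact (hf.fderiv_right (by simp)).clm_apply contDiff_const

lemma pd_add {f g : Euc n → ℝ} (hf : ContDiff ℝ ∞ f) (hg : ContDiff ℝ ∞ g) (i : Fin n) (x : Euc n) :
    pd i (fun y => f y + g y) x = pd i f x + pd i g x := by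
  unfold pd
  rw [fderiv_fun_add (sm_da hf x) (sm_da hg x)]; rfl

lemma pd_sub {f g : Euc n → ℝ} (hf : ContDiff ℝ ∞ f) (hg : ContDiff ℝ ∞ g) (i : Fin n) (x : Euc n) :
    pd i (fun y => f y - g y) x = pd i f x - pd i g x := by
  unfold pd
  rw [fderiv_fun_sub (sm_da hf x) (sm_da hg x)]; rfl

lemma pd_mul {f g : Euc n → ℝ} (hf : ContDiff ℝ ∞ f) (hg : ContDiff ℝ ∞ g) (i : Fin n) (x : Euc n) :
    pd i (fun y => f y * g y) x = f x * pd i g x + g x * pd i f x := by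
  unfold pd
  rw [fderiv_fun_mul (sm_da hf x) (sm_da hg x)]; simp

lemma pd_mulc {f : Euc n → ℝ} (hf : ContDiff ℝ ∞ f) (c : ℝ) (i : Fin n) (x : Euc n) :
    pd i (fun y => f y * c) x = pd i f x * c := by
  unfold pd
  rw [fderiv_mul_const (sm_da hf x)]; simp [mul_comm]

lemma pd_cmul {f : Euc n → ℝ} (hf : ContDiff ℝ ∞ f) (c : ℝ) (i : Fin n) (x : Euc n) :
    pd i (fun y => c * f y) x = c * pd i f x := by
  unfold pd
  rw [fderiv_const_mul (sm_da hf x)]; simp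

lemma pd_coord (i l : Fin n) (x : Euc n) : pd i (fun y : Euc n => y l) x = kd l i := by
  unfold pd kd
  have : (fun y : Euc n => y l) = ⇑(EuclideanSpace.proj l : Euc n →L[ℝ] ℝ) := rfl
  rw [this, ContinuousLinearMap.fderiv]
  simp

lemma coord_sm (l : Fin n) : ContDiff ℝ ∞ (fun y : Euc n => y l) :=
  (EuclideanSpace.proj l : Euc n →L[ℝ] ℝ).contDiff

lemma pd_comm {f : Euc n → ℝ} (hf : ContDiff ℝ ∞ f) (i j : Fin n) (x : Euc n) :
    pd i (pd j f) x = pd j (pd i f) x := by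
  have hs : IsSymmSndFDerivAt ℝ f x := by
    apply ContDiffAt.isSymmSndFDerivAt (n := ∞) hf.contDiffAt
    simp
    exact WithTop.coe_le_coe.mpr (le_top : (2 : ℕ∞) ≤ ⊤)
  have hd : DifferentiableAt ℝ (fderiv ℝ f) x :=
    ((hf.fderiv_right (m := ∞) (by simp)).differentiable (by simp)) x
  have key : ∀ a b : Fin n, pd a (pd b f) x =
      fderiv ℝ (fderiv ℝ f) x (EuclideanSpace.single a 1) (EuclideanSpace.single b 1) := by
    intro a b
    unfold pd
    rw [fderiv_clm_apply hd (differentiableAt_const _)]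
    simp
  rw [key, key]
  exact hs _ _

lemma pd_comp_smul (f : Euc n → ℝ) (r : ℝ) (i : Fin n) (x : Euc n) :
    pd i (fun y => f (r • y)) x = r * pd i f (r • x) := by
  unfold pd
  rw [fderiv_comp_smul]
  simp

lemma kd_comm (i k : Fin n) : kd i k = kd k i := by
  unfold kd; simp [eq_comm]

def ro (ε : ℝ) (x : Euc n) : ℝ := (ε ^ 2 + ‖x‖ ^ 2)⁻¹
def ff (ε : ℝ) (p : Fin n) (x : Euc n) : ℝ := ro ε x * (-2 * x p)

lemma den_pos {ε : ℝ} (he : 0 < ε) (x : Euc n) : 0 < ε ^ 2 + ‖x‖ ^ 2 := by positivity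

lemma den_sm (ε : ℝ) : ContDiff ℝ ∞ (fun x : Euc n => ε ^ 2 + ‖x‖ ^ 2) :=
  contDiff_const.add (contDiff_norm_sq ℝ)

lemma ro_sm {ε : ℝ} (he : 0 < ε) : ContDiff ℝ ∞ (ro ε : Euc n → ℝ) :=
  (den_sm ε).inv (fun x => (den_pos he x).ne')

lemma ff_sm {ε : ℝ} (he : 0 < ε) (p : Fin n) : ContDiff ℝ ∞ (ff ε p : Euc n → ℝ) :=
  (ro_sm he).mul (contDiff_const.mul (coord_sm p))

lemma den_fd (ε : ℝ) (x : Euc n) : HasFDerivAt (fun x : Euc n => ε ^ 2 + ‖x‖ ^ 2)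
    (2 • (innerSL ℝ x)) x := by
  have := (hasStrictFDerivAt_norm_sq x).hasFDerivAt
  exact this.const_add _

lemma ro_pd {ε : ℝ} (he : 0 < ε) (p : Fin n) (x : Euc n) : pd p (ro ε) x = ro ε x * ff ε p x := by
  have h := (hasDerivAt_inv (den_pos he x).ne').comp_hasFDerivAt x (den_fd ε x)
  unfold pd
  have e : fderiv ℝ (ro ε) x = _ := h.fderiv
  rw [e]
  simp [ff, ro, EuclideanSpace.inner_single_right]
  field_simp

lemma ff_pd {ε : ℝ} (he : 0 < ε) (j l : Fin n) (x : Euc n) :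
    pd j (ff ε l) x = -2 * ro ε x * kd l j + ff ε l x * ff ε j x := by
  have : pd j (ff ε l) x = pd j (fun y => ro ε y * (-2 * y l)) x := rfl
  rw [this, pd_mul (ro_sm he) (contDiff_const.mul (coord_sm l)), pd_cmul (coord_sm l), pd_coord,
    ro_pd he]
  unfold ff; ring

lemma uE_eq {ε : ℝ} (x : Euc n) : uE n ε x = (ε * ro ε x) ^ (((n : ℝ) - 2) / 2) := rfl

lemma uE_pos {ε : ℝ} (he : 0 < ε) (x : Euc n) : 0 < uE n ε x := by
  have := den_pos he x
  unfold uE; positivity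

lemma uE_pd {ε : ℝ} (he : 0 < ε) (p : Fin n) (x : Euc n) :
    pd p (uE n ε) x = (((n : ℝ) - 2) / 2) * (uE n ε x * ff ε p x) := by
  have hp := den_pos he x
  have h0 : 0 < ε * ro ε x := by unfold ro; positivity
  have h1 : HasFDerivAt (ro ε) (fderiv ℝ (ro ε) x) x := (sm_da (ro_sm he) x).hasFDerivAt
  have h := (h1.const_mul ε).rpow_const (p := ((n : ℝ) - 2) / 2) (Or.inl h0.ne')
  have e : fderiv ℝ (uE n ε) x = _ := h.fderiv
  have r := ro_pd he p x
  have hr : ro ε x ≠ 0 := by unfold ro; positivity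
  unfold pd at r ⊢
  rw [e]
  simp only [_root_.smul_apply, smul_eq_mul, r]
  rw [Real.rpow_sub_one h0.ne', uE_eq]
  field_simp

def Pop (ε : ℝ) (T : Fin n → Fin n → Euc n → ℝ) (i k l : Fin n) : Euc n → ℝ := fun x =>
  pd l (T i k) x - ff ε i x * T k l x - ff ε k x * T i l x
    + (∑ p, ff ε p x * T i p x) * kd k l + (∑ p, ff ε p x * T k p x) * kd i l

lemma Q_eq (hn : 3 ≤ n) {ε : ℝ} (he : 0 < ε) (H : Fin n → Fin n → Euc n → ℝ)
    (V : Fin n → Euc n → ℝ) (i k l : Fin n) (x : Euc n) :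
    Qop ε H V i k l x = uE n ε x * Pop ε (Tten H V) i k l x := by
  have hn' : ((n : ℝ) - 2) ≠ 0 := by
    have : (3 : ℝ) ≤ n := by exact_mod_cast hn
    intro h; linarith
  have e : ∀ a : Fin n, ∑ p, pd p (uE n ε) x * Tten H V a p x =
      (((n : ℝ) - 2) / 2) * (uE n ε x * ∑ p, ff ε p x * Tten H V a p x) := by
    intro a
    rw [Finset.mul_sum, Finset.mul_sum]
    refine Finset.sum_congr rfl fun p _ => ?_
    rw [uE_pd he]; ring
  unfold Qop Pop
  rw [e, e, uE_pd he, uE_pd he]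
  field_simp

end pdlemmas

open scoped ContDiff

section ident
variable {n : ℕ}

def relf (T : Fin n → Fin n → Euc n → ℝ) (i j k l : Fin n) (x : Euc n) : ℝ :=
  pd j (pd k (T i l)) x + pd i (pd l (T j k)) x - pd i (pd k (T j l)) x - pd j (pd l (T i k)) x

def KNf (M : Fin n → Fin n → ℝ) (i j k l : Fin n) : ℝ :=
  M j l * kd i k + M i k * kd j l - M j k * kd i l - M i l * kd j k

/-- Antisymmetrized first order quantity. -/
def Sa (P : Fin n → Fin n → Fin n → Euc n → ℝ) (i k l : Fin n) (x : Euc n) : ℝ :=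
  P i l k x - P i k l x

def Dop (ε : ℝ) (P : Fin n → Fin n → Fin n → Euc n → ℝ) (i j k l : Fin n) (x : Euc n) : ℝ :=
  pd j (Sa P i k l) x - pd i (Sa P j k l) x + ff ε l x * Sa P k j i x - ff ε k x * Sa P l j i x

lemma th_sm {ε : ℝ} (he : 0 < ε) {T : Fin n → Fin n → Euc n → ℝ}
    (hT : ∀ i k, ContDiff ℝ ∞ (T i k)) (a : Fin n) :
    ContDiff ℝ ∞ (fun x => ∑ p, ff ε p x * T a p x) :=
  ContDiff.sum fun p _ => (ff_sm he p).mul (hT a p)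

lemma Pop_sm {ε : ℝ} (he : 0 < ε) {T : Fin n → Fin n → Euc n → ℝ}
    (hT : ∀ i k, ContDiff ℝ ∞ (T i k)) (i k l : Fin n) : ContDiff ℝ ∞ (Pop ε T i k l) := by
  unfold Pop
  exact (((((pd_sm (hT i k) l).sub ((ff_sm he i).mul (hT k l))).sub
    ((ff_sm he k).mul (hT i l))).add ((th_sm he hT i).mul contDiff_const)).add
    ((th_sm he hT k).mul contDiff_const))

lemma Sa_sm {P : Fin n → Fin n → Fin n → Euc n → ℝ} (hP : ∀ i k l, ContDiff ℝ ∞ (P i k l))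
    (i k l : Fin n) : ContDiff ℝ ∞ (Sa P i k l) := by
  unfold Sa; exact (hP i l k).sub (hP i k l)

lemma Sa_eq {ε : ℝ} {T : Fin n → Fin n → Euc n → ℝ} (hs : ∀ i k, T i k = T k i)
    (i k l : Fin n) : Sa (Pop ε T) i k l = fun x =>
      pd k (T i l) x - pd l (T i k) x - ff ε l x * T i k x + ff ε k x * T i l x
      + (∑ p, ff ε p x * T l p x) * kd i k - (∑ p, ff ε p x * T k p x) * kd i l := by
  funext x
  unfold Sa Pop
  rw [hs l k, kd_comm l k]
  ring

lemma relf_eq {ε : ℝ} (he : 0 < ε) {T : Fin n → Fin n → Euc n → ℝ}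
    (hT : ∀ i k, ContDiff ℝ ∞ (T i k)) (hs : ∀ i k, T i k = T k i) (i j k l : Fin n)
    (x : Euc n) : relf T i j k l x = Dop ε (Pop ε T) i j k l x
      - KNf (fun a b => pd a (fun x => ∑ p, ff ε p x * T b p x) x + 2 * ro ε x * T a b x
          - ff ε b x * (∑ p, ff ε p x * T a p x)) i j k l := by
  have key : ∀ a b c e : Fin n, pd b (Sa (Pop ε T) a c e) x =
      pd b (pd c (T a e)) x - pd b (pd e (T a c)) x
      - (ff ε e x * pd b (T a c) x + T a c x * pd b (ff ε e) x)
      + (ff ε c x * pd b (T a e) x + T a e x * pd b (ff ε c) x)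
      + pd b (fun x => ∑ p, ff ε p x * T e p x) x * kd a c
      - pd b (fun x => ∑ p, ff ε p x * T c p x) x * kd a e := by
    intro a b c e
    have s1 := pd_sm (hT a e) c
    have s2 := pd_sm (hT a c) e
    have s3 := (ff_sm he e).mul (hT a c)
    have s4 := (ff_sm he c).mul (hT a e)
    have s5 := (th_sm he hT e)
    have s6 := (th_sm he hT c)
    have c5 : ContDiff ℝ ∞ (fun x : Euc n => (∑ p, ff ε p x * T e p x) * kd a c) :=
      s5.mul contDiff_const
    have c6 : ContDiff ℝ ∞ (fun x : Euc n => (∑ p, ff ε p x * T c p x) * kd a e) :=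
      s6.mul contDiff_const
    rw [Sa_eq hs, pd_sub ((((s1.sub s2).sub s3).add s4).add c5) c6,
      pd_add (((s1.sub s2).sub s3).add s4) c5, pd_add ((s1.sub s2).sub s3) s4,
      pd_sub (s1.sub s2) s3, pd_sub s1 s2, pd_mul (ff_sm he e) (hT a c),
      pd_mul (ff_sm he c) (hT a e), pd_mulc s5, pd_mulc s6]
  unfold Dop
  rw [key, key, Sa_eq hs, Sa_eq hs]
  simp only [ff_pd he]
  unfold relf KNf
  rw [hs k j, hs k i, hs l j, hs l i, kd_comm k j, kd_comm k i, kd_comm l j, kd_comm l i]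
  ring

lemma Sop_sm {V : Fin n → Euc n → ℝ} (hV : ∀ i, ContDiff ℝ ∞ (V i)) (i k : Fin n) :
    ContDiff ℝ ∞ (Sop V i k) := by
  unfold Sop
  exact ((pd_sm (hV k) i).add (pd_sm (hV i) k)).sub
    ((contDiff_const.mul (ContDiff.sum fun m _ => pd_sm (hV m) m)).mul contDiff_const)

lemma pd2_sub {f g : Euc n → ℝ} (hf : ContDiff ℝ ∞ f) (hg : ContDiff ℝ ∞ g) (i j : Fin n)
    (x : Euc n) : pd i (pd j (fun y => f y - g y)) x = pd i (pd j f) x - pd i (pd j g) x := by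
  have : pd j (fun y => f y - g y) = fun y => pd j f y - pd j g y := by
    funext y; exact pd_sub hf hg j y
  rw [this, pd_sub (pd_sm hf j) (pd_sm hg j)]

lemma pd2_add {f g : Euc n → ℝ} (hf : ContDiff ℝ ∞ f) (hg : ContDiff ℝ ∞ g) (i j : Fin n)
    (x : Euc n) : pd i (pd j (fun y => f y + g y)) x = pd i (pd j f) x + pd i (pd j g) x := by
  have : pd j (fun y => f y + g y) = fun y => pd j f y + pd j g y := by
    funext y; exact pd_add hf hg j y
  rw [this, pd_add (pd_sm hf j) (pd_sm hg j)]

lemma pd2_mulc {f : Euc n → ℝ} (hf : ContDiff ℝ ∞ f) (c : ℝ) (i j : Fin n)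
    (x : Euc n) : pd i (pd j (fun y => f y * c)) x = pd i (pd j f) x * c := by
  have : pd j (fun y => f y * c) = fun y => pd j f y * c := by
    funext y; exact pd_mulc hf c j y
  rw [this, pd_mulc (pd_sm hf j)]

lemma relf_S {V : Fin n → Euc n → ℝ} (hV : ∀ i, ContDiff ℝ ∞ (V i)) :
    ∃ M : Euc n → Fin n → Fin n → ℝ, ∀ i j k l x, relf (Sop V) i j k l x = KNf (M x) i j k l := by
  set g : Euc n → ℝ := fun x => (2 / (n : ℝ)) * ∑ m, pd m (V m) x with hg
  have gs : ContDiff ℝ ∞ g := contDiff_const.mul (ContDiff.sum fun m _ => pd_sm (hV m) m)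
  refine ⟨fun x a b => pd a (pd b g) x, fun i j k l x => ?_⟩
  have key : ∀ a b c e : Fin n, pd a (pd b (Sop V c e)) x =
      pd a (pd b (pd c (V e))) x + pd a (pd b (pd e (V c))) x - pd a (pd b g) x * kd c e := by
    intro a b c e
    have s1 := pd_sm (hV e) c
    have s2 := pd_sm (hV c) e
    have s3 : ContDiff ℝ ∞ (fun x => g x * kd c e) := gs.mul contDiff_const
    have : Sop V c e = fun x => (pd c (V e) x + pd e (V c) x) - g x * kd c e := rfl
    rw [this, pd2_sub (s1.add s2) s3, pd2_add s1 s2, pd2_mulc gs]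
  have sw : ∀ (f : Euc n → ℝ), ContDiff ℝ ∞ f → ∀ a b, pd a (pd b f) = pd b (pd a f) := by
    intro f hf a b; funext y; exact pd_comm hf a b y
  unfold relf KNf
  simp only [key]
  -- third derivatives commute
  have t1 : pd j (pd k (pd i (V l))) x = pd i (pd k (pd j (V l))) x := by
    rw [sw _ (hV l) k i, sw _ (hV l) k j, sw _ (pd_sm (hV l) k) j i]
  have t2 : pd j (pd l (pd i (V k))) x = pd i (pd l (pd j (V k))) x := by
    rw [sw _ (hV k) l i, sw _ (hV k) l j, sw _ (pd_sm (hV k) l) j i]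
  rw [t1, t2, sw _ (hV i) l k, sw _ (hV j) l k]
  ring

lemma Tten_sm {H : Fin n → Fin n → Euc n → ℝ} {V : Fin n → Euc n → ℝ}
    (hH : ∀ i k, ContDiff ℝ ∞ (H i k)) (hV : ∀ i, ContDiff ℝ ∞ (V i)) (i k : Fin n) :
    ContDiff ℝ ∞ (Tten H V i k) := (hH i k).sub (Sop_sm hV i k)

lemma Tten_symm {H : Fin n → Fin n → Euc n → ℝ} {V : Fin n → Euc n → ℝ}
    (hs : ∀ i k x, H i k x = H k i x) (i k : Fin n) :
    Tten H V i k = Tten H V k i := by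
  funext x
  unfold Tten Sop
  rw [hs i k x, kd_comm i k]; ring

lemma relf_H {ε : ℝ} (he : 0 < ε) {H : Fin n → Fin n → Euc n → ℝ} {V : Fin n → Euc n → ℝ}
    (hH : ∀ i k, ContDiff ℝ ∞ (H i k)) (hs : ∀ i k x, H i k x = H k i x)
    (hV : ∀ i, ContDiff ℝ ∞ (V i)) :
    ∃ M : Euc n → Fin n → Fin n → ℝ, ∀ i j k l x,
      relf H i j k l x = Dop ε (Pop ε (Tten H V)) i j k l x + KNf (M x) i j k l := by
  obtain ⟨M, hM⟩ := relf_S hV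
  refine ⟨fun x a b => M x a b - (pd a (fun x => ∑ p, ff ε p x * Tten H V b p x) x
    + 2 * ro ε x * Tten H V a b x - ff ε b x * (∑ p, ff ε p x * Tten H V a p x)),
    fun i j k l x => ?_⟩
  have e1 := relf_eq he (Tten_sm hH hV) (Tten_symm hs) i j k l x
  have e2 : relf (Tten H V) i j k l x = relf H i j k l x - relf (Sop V) i j k l x := by
    have key : ∀ a b c e : Fin n, pd a (pd b (Tten H V c e)) x =
      pd a (pd b (H c e)) x - pd a (pd b (Sop V c e)) x := fun a b c e =>
        pd2_sub (hH c e) (Sop_sm hV c e) a b x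
    unfold relf
    simp only [key]; ring
  rw [hM] at e2
  unfold KNf at *
  linear_combination e1 - e2

end ident

open scoped ContDiff

section weak
variable {n : ℕ}

/-- Half annulus. -/
def Us (l₀ : Fin n) (r : ℝ) : Set (Euc n) := {x | r / 2 < ‖x‖ ∧ ‖x‖ < r ∧ 0 < x l₀}

lemma cc (l₀ : Fin n) : Continuous (fun x : Euc n => x l₀) := (coord_sm l₀).continuous

lemma Us_open (l₀ : Fin n) (r : ℝ) : IsOpen (Us l₀ r) := by
  unfold Us
  exact (isOpen_lt continuous_const continuous_norm).inter
    ((isOpen_lt continuous_norm continuous_const).inter (isOpen_lt continuous_const (cc l₀)))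

lemma Us_sub (l₀ : Fin n) (r : ℝ) : Us l₀ r ⊆ closedBall 0 r := by
  intro x hx
  simp only [mem_closedBall, dist_zero_right]
  exact hx.2.1.le

lemma cont_int {s : Set (Euc n)} {r : ℝ} (hs : s ⊆ closedBall 0 r) {F : Euc n → ℝ}
    (hF : Continuous F) : IntegrableOn F s :=
  (hF.continuousOn.integrableOn_compact (isCompact_closedBall 0 r)).mono_set hs

lemma int4 {μ : Measure (Euc n)} {a b c e : Euc n → ℝ} (ha : Integrable a μ) (hb : Integrable b μ)
    (hc : Integrable c μ) (he : Integrable e μ) : ∫ x, (a x - b x + c x - e x) ∂μ =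
      ∫ x, a x ∂μ - ∫ x, b x ∂μ + ∫ x, c x ∂μ - ∫ x, e x ∂μ := by
  have h1 : Integrable (fun x => a x - b x) μ := ha.sub hb
  have h2 : Integrable (fun x => a x - b x + c x) μ := h1.add hc
  rw [integral_sub h2 he, integral_add h1 hc, integral_sub ha hb]

lemma cs_bd {s : Set (Euc n)} {r : ℝ} (hs : s ⊆ closedBall 0 r) {F : Euc n → ℝ}
    (hF : Continuous F) : |∫ x in s, F x| ≤ √(volume.real s) * √(∫ x in s, F x ^ 2) := by
  have hfin : volume s < ⊤ := lt_of_le_of_lt (measure_mono hs) (isCompact_closedBall 0 r).measure_lt_top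
  have i1 := cont_int hs hF
  have i2 : IntegrableOn (fun x => F x ^ 2) s := cont_int hs (hF.pow 2)
  have ic : ∀ c : ℝ, IntegrableOn (fun _ : Euc n => c) s := fun c => cont_int hs continuous_const
  have key : ∀ t : ℝ, 2 * t * (∫ x in s, F x) ≤ (∫ x in s, F x ^ 2) + t ^ 2 * volume.real s := by
    intro t
    have h0 : 0 ≤ ∫ x in s, (F x - t) ^ 2 := integral_nonneg fun x => sq_nonneg _
    have e : ∀ x, (F x - t) ^ 2 = F x ^ 2 - 2 * t * F x + t ^ 2 := fun x => by ring
    simp only [e] at h0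
    have h1 : IntegrableOn (fun x => F x ^ 2 - 2 * t * F x) s := i2.sub (i1.const_mul (2 * t))
    rw [integral_add h1 (ic (t ^ 2)),
      integral_sub i2 (i1.const_mul (2 * t)), integral_const_mul, setIntegral_const] at h0
    simp only [smul_eq_mul] at h0
    linarith
  rw [← Real.sqrt_mul measureReal_nonneg]
  apply Real.abs_le_sqrt
  set v := volume.real s
  have hv : 0 ≤ v := measureReal_nonneg
  rcases hv.eq_or_lt with h | h
  · have : volume s = 0 := by
      have := h.symm
      rwa [measureReal_eq_zero_iff hfin.ne] at this
    rw [Measure.restrict_eq_zero.mpr this]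
    simp
  · have := key ((∫ x in s, F x) / v)
    field_simp at this
    nlinarith

lemma ibp {ψ f : Euc n → ℝ} (hψ : ContDiff ℝ ∞ ψ) (hc : HasCompactSupport ψ)
    (hf : ContDiff ℝ ∞ f) (j : Fin n) : ∫ x, ψ x * pd j f x = - ∫ x, pd j ψ x * f x := by
  have hc' : HasCompactSupport (pd j ψ) := by
    have := hc.fderiv (𝕜 := ℝ)
    exact this.comp_left (g := fun L : Euc n →L[ℝ] ℝ => L (EuclideanSpace.single j 1)) rfl
  unfold pd
  apply integral_mul_fderiv_eq_neg_fderiv_mul_of_integrable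
  · exact ((pd_sm hψ j).continuous.mul hf.continuous).integrable_of_hasCompactSupport hc'.mul_right
  · exact (hψ.continuous.mul (pd_sm hf j).continuous).integrable_of_hasCompactSupport hc.mul_right
  · exact (hψ.continuous.mul hf.continuous).integrable_of_hasCompactSupport hc.mul_right
  · exact fun x _ => sm_da hψ x
  · exact fun x _ => sm_da hf x

lemma pd_supp {ψ : Euc n → ℝ} {j : Fin n} {x : Euc n} (hx : x ∉ tsupport ψ) : pd j ψ x = 0 := by
  unfold pd
  rw [fderiv_of_notMem_tsupport (𝕜 := ℝ) hx]; rfl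

lemma pd_cs {ψ : Euc n → ℝ} (hc : HasCompactSupport ψ) (j : Fin n) : HasCompactSupport (pd j ψ) := by
  have := hc.fderiv (𝕜 := ℝ)
  exact this.comp_left (g := fun L : Euc n →L[ℝ] ℝ => L (EuclideanSpace.single j 1)) rfl

lemma coord_le (x : Euc n) (p : Fin n) : |x p| ≤ ‖x‖ := by
  have := PiLp.norm_apply_le x p
  simpa using this

lemma ff_bd {s : ℝ} (p : Fin n) {x : Euc n} (hx : 1 / 2 < ‖x‖) : |ff s p x| ≤ 4 := by
  unfold ff ro
  have h0 : 0 < s ^ 2 + ‖x‖ ^ 2 := by nlinarith [sq_nonneg s]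
  rw [abs_mul, abs_inv, abs_of_pos h0, abs_mul, inv_mul_le_iff₀ h0]
  have := coord_le x p
  norm_num
  nlinarith [sq_nonneg s]

def Esq (P : Fin n → Fin n → Fin n → Euc n → ℝ) (x : Euc n) : ℝ := ∑ i, ∑ k, ∑ l, P i k l x ^ 2

lemma Esq_nonneg (P : Fin n → Fin n → Fin n → Euc n → ℝ) (x : Euc n) : 0 ≤ Esq P x := by
  unfold Esq; positivity

lemma le_Esq (P : Fin n → Fin n → Fin n → Euc n → ℝ) (i k l : Fin n) (x : Euc n) :
    |P i k l x| ≤ √(Esq P x) := by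
  apply Real.abs_le_sqrt
  unfold Esq
  calc P i k l x ^ 2 ≤ ∑ l, P i k l x ^ 2 :=
        Finset.single_le_sum (f := fun l => P i k l x ^ 2) (fun _ _ => sq_nonneg _) (Finset.mem_univ l)
    _ ≤ ∑ k, ∑ l, P i k l x ^ 2 :=
        Finset.single_le_sum (f := fun k => ∑ l, P i k l x ^ 2) (fun _ _ => by positivity)
          (Finset.mem_univ k)
    _ ≤ _ := Finset.single_le_sum (f := fun i => ∑ k, ∑ l, P i k l x ^ 2)
          (fun _ _ => by positivity) (Finset.mem_univ i)

lemma Esq_cont {P : Fin n → Fin n → Fin n → Euc n → ℝ} (hP : ∀ i k l, Continuous (P i k l)) :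
    Continuous (Esq P) := by
  unfold Esq
  exact continuous_finsetSum _ fun i _ => continuous_finsetSum _ fun k _ =>
    continuous_finsetSum _ fun l _ => (hP i k l).pow 2

lemma dop_bd (l₀ : Fin n) {ψ : Euc n → ℝ} (hψ : ContDiff ℝ ∞ ψ) (hc : HasCompactSupport ψ)
    (hU : tsupport ψ ⊆ Us l₀ 1) : ∃ c : ℝ, 0 ≤ c ∧ ∀ s : ℝ, 0 < s →
      ∀ P : Fin n → Fin n → Fin n → Euc n → ℝ, (∀ i k l, ContDiff ℝ ∞ (P i k l)) →
      ∀ i j k l, Integrable (fun x => ψ x * Dop s P i j k l x) ∧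
        |∫ x, ψ x * Dop s P i j k l x| ≤ c * √(∫ x in Us l₀ 1, Esq P x) := by
  obtain ⟨B0, hB0⟩ := hc.exists_bound_of_continuous hψ.continuous
  choose B1 hB1 using fun j => (pd_cs hc j).exists_bound_of_continuous (pd_sm hψ j).continuous
  set B : ℝ := |B0| + ∑ j, |B1 j| with hB
  have hBn : 0 ≤ B := by positivity
  have b0 : ∀ x, |ψ x| ≤ B := fun x => by
    have := hB0 x
    have h2 : 0 ≤ ∑ j, |B1 j| := by positivity
    rw [Real.norm_eq_abs] at this
    linarith [le_abs_self B0]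
  have b1 : ∀ j x, |pd j ψ x| ≤ B := fun j x => by
    have := hB1 j x
    rw [Real.norm_eq_abs] at this
    have h2 : |B1 j| ≤ ∑ j, |B1 j| :=
      Finset.single_le_sum (f := fun j => |B1 j|) (fun _ _ => abs_nonneg _) (Finset.mem_univ j)
    linarith [le_abs_self (B1 j), abs_nonneg B0]
  refine ⟨20 * B * √(volume.real (Us l₀ 1)), by positivity, ?_⟩
  intro s hs P hP i j k l
  have hS := fun a b c => Sa_sm hP a b c
  have I : ∀ {f : Euc n → ℝ}, Continuous f → Integrable (fun x => ψ x * f x) := fun hf =>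
    (hψ.continuous.mul hf).integrable_of_hasCompactSupport hc.mul_right
  have I' : ∀ {f : Euc n → ℝ} (j), Continuous f → Integrable (fun x => pd j ψ x * f x) := fun j hf =>
    ((pd_sm hψ j).continuous.mul hf).integrable_of_hasCompactSupport (pd_cs hc j).mul_right
  have i1 := I (pd_sm (hS i k l) j).continuous
  have i2 := I (pd_sm (hS j k l) i).continuous
  have i3 : Integrable (fun x => ψ x * (ff s l x * Sa P k j i x)) := I ((ff_sm hs l).continuous.mul (hS k j i).continuous)
  have i4 : Integrable (fun x => ψ x * (ff s k x * Sa P l j i x)) := I ((ff_sm hs k).continuous.mul (hS l j i).continuous)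
  have j1 := I' j (hS i k l).continuous
  have j2 := I' i (hS j k l).continuous
  have e : (fun x => ψ x * Dop s P i j k l x) = fun x => ψ x * pd j (Sa P i k l) x
      - ψ x * pd i (Sa P j k l) x + ψ x * (ff s l x * Sa P k j i x)
      - ψ x * (ff s k x * Sa P l j i x) := by
    funext x; unfold Dop; ring
  refine ⟨by rw [e]; exact ((i1.sub i2).add i3).sub i4, ?_⟩
  have e2 : ∫ x, ψ x * Dop s P i j k l x = ∫ x, (- (pd j ψ x * Sa P i k l x)
      + pd i ψ x * Sa P j k l x + ψ x * (ff s l x * Sa P k j i x)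
      - ψ x * (ff s k x * Sa P l j i x)) := by
    rw [e, int4 i1 i2 i3 i4, ibp hψ hc (hS i k l), ibp hψ hc (hS j k l), ← integral_neg]
    have := int4 j1.neg j2.neg i3 i4
    simp only [Pi.neg_apply, sub_neg_eq_add, integral_neg (fun x => pd i ψ x * Sa P j k l x)] at this
    rw [this]
    ring
  have hF : Continuous (fun x => √(Esq P x)) := (Esq_cont fun i k l => (hP i k l).continuous).sqrt
  have hm : MeasurableSet (Us l₀ 1) := (Us_open l₀ 1).measurableSet
  have pt : ∀ x, |(- (pd j ψ x * Sa P i k l x)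
      + pd i ψ x * Sa P j k l x + ψ x * (ff s l x * Sa P k j i x)
      - ψ x * (ff s k x * Sa P l j i x))| ≤ (Us l₀ 1).indicator (fun x => 20 * B * √(Esq P x)) x := by
    intro x
    by_cases hx : x ∈ Us l₀ 1
    · rw [Set.indicator_of_mem hx]
      set F := √(Esq P x) with hFd
      have hF0 : 0 ≤ F := Real.sqrt_nonneg _
      have hSb : ∀ a b c, |Sa P a b c x| ≤ 2 * F := fun a b c => by
        unfold Sa
        calc _ ≤ |P a c b x| + |P a b c x| := abs_sub _ _
          _ ≤ F + F := add_le_add (le_Esq P _ _ _ x) (le_Esq P _ _ _ x)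
          _ = _ := by ring
      have hf : ∀ p, |ff s p x| ≤ 4 := fun p => ff_bd p (by simpa using hx.1)
      have t1 : ∀ j a b c, |pd j ψ x * Sa P a b c x| ≤ B * (2 * F) := fun j a b c => by
        rw [abs_mul]; exact mul_le_mul (b1 j x) (hSb _ _ _) (abs_nonneg _) hBn
      have t2 : ∀ p a b c, |ψ x * (ff s p x * Sa P a b c x)| ≤ B * (4 * (2 * F)) := fun p a b c => by
        rw [abs_mul, abs_mul]
        exact mul_le_mul (b0 x) (mul_le_mul (hf p) (hSb _ _ _) (abs_nonneg _) (by norm_num))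
          (by positivity) hBn
      have u1 := abs_le.mp (t1 j i k l)
      have u2 := abs_le.mp (t1 i j k l)
      have u3 := abs_le.mp (t2 l k j i)
      have u4 := abs_le.mp (t2 k l j i)
      rw [abs_le]
      constructor <;> linarith
    · rw [Set.indicator_of_notMem hx]
      have hx' : x ∉ tsupport ψ := fun h => hx (hU h)
      rw [pd_supp hx', pd_supp hx', image_eq_zero_of_notMem_tsupport hx']
      simp
  rw [e2]
  have ind : Integrable ((Us l₀ 1).indicator (fun x => 20 * B * √(Esq P x))) :=
    (integrable_indicator_iff hm).mpr (cont_int (Us_sub l₀ 1) (continuous_const.mul hF))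
  have h1 := norm_integral_le_of_norm_le ind (f := fun x => (- (pd j ψ x * Sa P i k l x)
      + pd i ψ x * Sa P j k l x + ψ x * (ff s l x * Sa P k j i x)
      - ψ x * (ff s k x * Sa P l j i x))) (Filter.Eventually.of_forall pt)
  rw [integral_indicator hm, integral_const_mul, Real.norm_eq_abs] at h1
  have h2 := cs_bd (Us_sub l₀ 1) hF
  have h3 : ∀ x, √(Esq P x) ^ 2 = Esq P x := fun x => Real.sq_sqrt (Esq_nonneg P x)
  simp only [h3] at h2
  calc _ ≤ _ := h1
    _ ≤ 20 * B * (√(volume.real (Us l₀ 1)) * √(∫ x in Us l₀ 1, Esq P x)) := by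
        gcongr; exact (le_abs_self _).trans h2
    _ = _ := by ring

end weak

open scoped ContDiff
set_option linter.unusedSimpArgs false
set_option linter.deprecated false

section evs
open MvPolynomial
variable {n : ℕ}

def ev (q : MvPolynomial (Fin n) ℝ) (x : Euc n) : ℝ := eval (fun m => x m) q

lemma ev_sm (q : MvPolynomial (Fin n) ℝ) : ContDiff ℝ ∞ (ev q) := by
  induction q using MvPolynomial.induction_on with
  | C a =>
    have : ev (C a : MvPolynomial (Fin n) ℝ) = fun _ => a := by funext x; simp [ev]
    rw [this]; exact contDiff_const
  | add p q hp hq =>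
    have : ev (p + q) = fun x => ev p x + ev q x := by funext x; simp [ev]
    rw [this]; exact hp.add hq
  | mul_X p i hp =>
    have : ev (p * X i) = fun x => ev p x * x i := by funext x; simp [ev]
    rw [this]; exact hp.mul (coord_sm i)

lemma ev_pd (l : Fin n) (q : MvPolynomial (Fin n) ℝ) : pd l (ev q) = ev (pderiv l q) := by
  induction q using MvPolynomial.induction_on with
  | C a =>
    have : ev (C a : MvPolynomial (Fin n) ℝ) = fun _ => a := by funext x; simp [ev]
    rw [this]; funext x; simp [pd, ev]
  | add p q hp hq =>
    have : ev (p + q) = fun x => ev p x + ev q x := by funext x; simp [ev]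
    rw [this]; funext x
    rw [pd_add (ev_sm p) (ev_sm q), hp, hq]; simp [ev]
  | mul_X p i hp =>
    have : ev (p * X i) = fun x => ev p x * x i := by funext x; simp [ev]
    rw [this]; funext x
    rw [pd_mul (ev_sm p) (coord_sm i), hp, pd_coord]
    simp only [ev, kd, Derivation.leibniz, pderiv_X, smul_eq_mul, map_add, map_mul, eval_X,
      Pi.single_apply]
    split_ifs <;> simp

lemma relf_ev (p : Fin n → Fin n → MvPolynomial (Fin n) ℝ) (i j k l : Fin n) (x : Euc n) :
    relf (fun a b => ev (p a b)) i j k l x = ev (Alg.rel p i j k l) x := by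
  unfold relf Alg.rel
  simp only [ev_pd]
  simp [ev]

lemma ev_zero_of_open {U : Set (Euc n)} (hU : IsOpen U) (hne : U.Nonempty)
    {q : MvPolynomial (Fin n) ℝ} (h : ∀ x ∈ U, ev q x = 0) : q = 0 := by
  obtain ⟨x0, hx0⟩ := hne
  have hc : Continuous (fun y : Fin n → ℝ => (WithLp.toLp 2 y : Euc n)) :=
    PiLp.continuous_toLp 2 _
  have ho := hU.preimage hc
  obtain ⟨e, he, hb⟩ := Metric.isOpen_iff.mp ho (x0.ofLp) (by simpa using hx0)
  apply MvPolynomial.funext_set (fun i => ball (x0 i) e)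
  · intro i
    rw [Real.ball_eq_Ioo]
    exact Set.Ioo_infinite (by linarith)
  · intro y hy
    have : y ∈ ball (x0.ofLp) e := by
      rw [ball_pi _ he]; exact hy
    have := h _ (hb this)
    simpa [ev] using this

lemma Us_ne (l₀ : Fin n) : (Us l₀ 1).Nonempty := by
  refine ⟨EuclideanSpace.single l₀ (3/4), ?_⟩
  simp only [Us, Set.mem_setOf_eq, EuclideanSpace.norm_single]
  norm_num

lemma ev_zero_of_test (l₀ : Fin n) {q : MvPolynomial (Fin n) ℝ}
    (h : ∀ ψ : Euc n → ℝ, ContDiff ℝ ∞ ψ → HasCompactSupport ψ → tsupport ψ ⊆ Us l₀ 1 →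
      ∫ x, ψ x * ev q x = 0) : q = 0 := by
  have hU := Us_open l₀ 1
  have h1 := hU.ae_eq_zero_of_integral_contDiff_smul_eq_zero (μ := volume) (f := ev q)
    ((ev_sm q).continuous.locallyIntegrable.locallyIntegrableOn _) h
  have h2 : Set.EqOn (ev q) 0 (Us l₀ 1) := by
    refine Measure.eqOn_open_of_ae_eq (μ := volume) ?_ hU (ev_sm q).continuous.continuousOn
      continuousOn_const
    exact (ae_restrict_iff' hU.measurableSet).mpr h1
  exact ev_zero_of_open hU (Us_ne l₀) h2

def Jt (ψ : Euc n → ℝ) (hψ : ContDiff ℝ ∞ ψ) (hc : HasCompactSupport ψ) :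
    MvPolynomial (Fin n) ℝ →ₗ[ℝ] ℝ where
  toFun q := ∫ x, ψ x * ev q x
  map_add' p q := by
    have I : ∀ p, Integrable (fun x => ψ x * ev p x) := fun p =>
      (hψ.continuous.mul (ev_sm p).continuous).integrable_of_hasCompactSupport hc.mul_right
    rw [← integral_add (I p) (I q)]
    congr 1; funext x; simp [ev]; ring
  map_smul' c q := by
    simp only [RingHom.id_apply, smul_eq_mul]
    rw [← integral_const_mul]
    congr 1; funext x; simp [ev]; ring
end evs

section dual
open MvPolynomial
variable (m d : ℕ)

abbrev Ed := Fin (m + 1) → Fin (m + 1) → (MIdx (m + 1) d) → ℝ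

variable {m d}

def pol (i k : Fin (m + 1)) : Ed m d →ₗ[ℝ] MvPolynomial (Fin (m + 1)) ℝ where
  toFun h := ∑ α : MIdx (m + 1) d, monomial (Finsupp.equivFunOnFinite.symm α.1) (h i k α)
  map_add' h g := by simp [Finset.sum_add_distrib]
  map_smul' c h := by simp [Finset.smul_sum, smul_monomial]

lemma pol_apply (i k : Fin (m + 1)) (h : Ed m d) : pol i k h =
    ∑ α : MIdx (m + 1) d, monomial (Finsupp.equivFunOnFinite.symm α.1) (h i k α) := rfl

def relL (i j k l : Fin (m + 1)) : Ed m d →ₗ[ℝ] MvPolynomial (Fin (m + 1)) ℝ where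
  toFun h := Alg.rel (fun a b => pol a b h) i j k l
  map_add' h g := by simp [Alg.rel]; ring
  map_smul' c h := by simp [Alg.rel, smul_sub]

variable (m d) in
def Kd : Submodule ℝ (Ed m d) where
  carrier := {h | (∀ i k, pol i k h = pol k i h) ∧ (∑ i, pol i i h = 0) ∧
    (∀ i, pol i (Fin.last m) h = 0) ∧ (∀ i, Alg.phi m (∑ k, pol i k h * X k) = 0) ∧
    (∀ i k, Alg.phi m (pderiv (Fin.last m) (pol i k h)) = 0)}
  add_mem' {a b} ha hb := by
    obtain ⟨a1, a2, a3, a4, a5⟩ := ha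
    obtain ⟨b1, b2, b3, b4, b5⟩ := hb
    refine ⟨fun i k => ?_, ?_, fun i => ?_, fun i => ?_, fun i k => ?_⟩
    · rw [map_add, map_add, a1, b1]
    · simp only [map_add, Finset.sum_add_distrib, a2, b2, add_zero]
    · rw [map_add, a3, b3, add_zero]
    · simp only [map_add, add_mul, Finset.sum_add_distrib, a4, b4, add_zero]
    · rw [map_add, map_add, map_add, a5, b5, add_zero]
  zero_mem' := by simp
  smul_mem' c a ha := by
    obtain ⟨a1, a2, a3, a4, a5⟩ := ha
    refine ⟨fun i k => ?_, ?_, fun i => ?_, fun i => ?_, fun i k => ?_⟩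
    · rw [map_smul, map_smul, a1]
    · simp only [map_smul, ← Finset.smul_sum, a2, smul_zero]
    · rw [map_smul, a3, smul_zero]
    · simp only [map_smul, smul_mul_assoc, ← Finset.smul_sum, a4, smul_zero]
    · rw [map_smul, Derivation.map_smul, map_smul, a5, smul_zero]

def Hh (h : Ed m d) : Fin (m + 1) → Fin (m + 1) → Euc (m + 1) → ℝ := fun i k => ev (pol i k h)

def Nn (h : Ed m d) (s : ℝ) (V : Fin (m + 1) → Euc (m + 1) → ℝ) : ℝ :=
  √(∫ x in Us (Fin.last m) 1, Esq (Pop s (Tten (Hh h) V)) x)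

variable (m d) in
def Ld : Submodule ℝ (Module.Dual ℝ (Kd m d)) where
  carrier := {L | ∃ c : ℝ, ∀ h : Kd m d, ∀ s : ℝ, 0 < s → ∀ V : Fin (m + 1) → Euc (m + 1) → ℝ,
    (∀ i, ContDiff ℝ ∞ (V i)) → |L h| ≤ c * Nn h.1 s V}
  add_mem' {a b} ha hb := by
    obtain ⟨c, hc⟩ := ha
    obtain ⟨c', hc'⟩ := hb
    refine ⟨c + c', fun h s hs V hV => ?_⟩
    rw [LinearMap.add_apply, add_mul]
    exact (abs_add_le _ _).trans (add_le_add (hc h s hs V hV) (hc' h s hs V hV))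
  zero_mem' := ⟨0, fun h s hs V hV => by simp⟩
  smul_mem' a L ha := by
    obtain ⟨c, hc⟩ := ha
    refine ⟨|a| * c, fun h s hs V hV => ?_⟩
    rw [LinearMap.smul_apply, smul_eq_mul, abs_mul, mul_assoc]
    exact mul_le_mul_of_nonneg_left (hc h s hs V hV) (abs_nonneg a)

lemma fam (a : Fin 4 → ℝ) (q1 q2 q3 q4 : Fin 4 → Fin (m + 1))
    (hk : ∀ M : Fin (m + 1) → Fin (m + 1) → ℝ,
      ∑ t, a t * KNf M (q1 t) (q2 t) (q3 t) (q4 t) = 0)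
    (h : Kd m d) (hh : ∀ L ∈ Ld m d, L h = 0) :
    ∑ t, a t • Alg.rel (fun a b => pol a b h.1) (q1 t) (q2 t) (q3 t) (q4 t) = 0 := by
  apply ev_zero_of_test (Fin.last m)
  intro ψ hψ hc hU
  set L : Module.Dual ℝ (Kd m d) :=
    (Jt ψ hψ hc ∘ₗ (∑ t, a t • relL (q1 t) (q2 t) (q3 t) (q4 t))) ∘ₗ (Kd m d).subtype with hL
  have hLe : ∀ g : Kd m d, L g = ∫ x, ψ x * ev (∑ t, a t •
      Alg.rel (fun a b => pol a b g.1) (q1 t) (q2 t) (q3 t) (q4 t)) x := by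
    intro g
    simp only [hL, LinearMap.comp_apply, Submodule.subtype_apply, LinearMap.sum_apply,
      LinearMap.smul_apply]
    rfl
  rw [← hLe]
  apply hh
  obtain ⟨c, hc0, hcb⟩ := dop_bd (Fin.last m) hψ hc hU
  refine ⟨(∑ t, |a t|) * c, fun g s hs V hV => ?_⟩
  have hsy : ∀ i k x, Hh g.1 i k x = Hh g.1 k i x := fun i k x => by
    unfold Hh; rw [g.2.1 i k]
  obtain ⟨M, hM⟩ := relf_H hs (fun i k => ev_sm (pol i k g.1)) hsy hV
  have hP : ∀ i k l, ContDiff ℝ ∞ (Pop s (Tten (Hh g.1) V) i k l) :=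
    Pop_sm hs (Tten_sm (fun i k => ev_sm (pol i k g.1)) hV)
  have e1 : L g = ∑ t, a t * ∫ x, ψ x *
      Dop s (Pop s (Tten (Hh g.1) V)) (q1 t) (q2 t) (q3 t) (q4 t) x := by
    rw [hLe]
    simp only [← integral_const_mul]
    rw [← integral_finsetSum _ fun t _ =>
      ((hcb s hs _ hP (q1 t) (q2 t) (q3 t) (q4 t)).1.const_mul (a t))]
    congr 1; funext x
    have e2 : ev (∑ t, a t • Alg.rel (fun a b => pol a b g.1) (q1 t) (q2 t) (q3 t) (q4 t)) x =
        ∑ t, a t * ev (Alg.rel (fun a b => pol a b g.1) (q1 t) (q2 t) (q3 t) (q4 t)) x := by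
      simp [ev]
    rw [e2]
    simp only [← relf_ev]
    have e3 : ∀ t, relf (fun a b => ev (pol a b g.1)) (q1 t) (q2 t) (q3 t) (q4 t) x =
      Dop s (Pop s (Tten (Hh g.1) V)) (q1 t) (q2 t) (q3 t) (q4 t) x
        + KNf (M x) (q1 t) (q2 t) (q3 t) (q4 t) := fun t => hM _ _ _ _ x
    simp only [e3, mul_add, Finset.sum_add_distrib, hk, mul_zero, add_zero, Finset.mul_sum]
    exact Finset.sum_congr rfl fun t _ => by ring
  rw [e1, Finset.sum_mul, Finset.sum_mul]
  refine (Finset.abs_sum_le_sum_abs _ _).trans (Finset.sum_le_sum fun t _ => ?_)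
  rw [abs_mul, mul_assoc]
  exact mul_le_mul_of_nonneg_left (hcb s hs _ hP _ _ _ _).2 (abs_nonneg _)

lemma wf_of (h : Kd m d) (hh : ∀ L ∈ Ld m d, L h = 0) :
    Alg.WF (Alg.rel (fun a b => pol a b h.1)) := by
  refine ⟨?_, ?_, ?_⟩
  · intro i j k l h1 h2 h3 h4 h5 h6
    have := fam ![1, 0, 0, 0] ![i, i, i, i] ![j, j, j, j] ![k, k, k, k] ![l, l, l, l] (by
      intro M
      simp [Fin.sum_univ_four, KNf, kd, h1, h2, h3, h4, h5, h6, h1.symm, h2.symm, h3.symm, h4.symm,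
        h5.symm, h6.symm]) h hh
    simpa [Fin.sum_univ_four] using this
  · intro i j k l h1 h2 h3 h4 h5 h6
    have := fam ![1, -1, 0, 0] ![i, i, i, i] ![k, l, l, l] ![j, j, j, j] ![k, l, l, l] (by
      intro M
      simp [Fin.sum_univ_four, KNf, kd, h1, h2, h3, h4, h5, h6, h1.symm, h2.symm, h3.symm, h4.symm,
        h5.symm, h6.symm]) h hh
    simpa [Fin.sum_univ_four, sub_eq_add_neg] using this
  · intro i j k l h1 h2 h3 h4 h5 h6
    have := fam ![1, -1, 1, -1] ![i, j, k, l] ![j, k, l, i] ![i, j, k, l] ![j, k, l, i] (by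
      intro M
      simp [Fin.sum_univ_four, KNf, kd, h1, h2, h3, h4, h5, h6, h1.symm, h2.symm, h3.symm, h4.symm,
        h5.symm, h6.symm]
      ring) h hh
    simpa [Fin.sum_univ_four, sub_eq_add_neg] using this

lemma MIdx_mem {n d : ℕ} {α : Fin n → ℕ} (h : α ∈ MIdx n d) : 2 ≤ ∑ i, α i := by
  unfold MIdx at h
  exact (Finset.mem_filter.mp h).2.1

lemma pol_coeff (h : Ed m d) (i k : Fin (m + 1)) (β : MIdx (m + 1) d) :
    coeff (Finsupp.equivFunOnFinite.symm β.1) (pol i k h) = h i k β := by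
  simp only [pol_apply, coeff_sum, coeff_monomial]
  rw [Finset.sum_eq_single β]
  · simp
  · intro α _ hα
    rw [if_neg]
    intro he
    exact hα (Subtype.ext (Finsupp.equivFunOnFinite.symm.injective he))
  · simp

lemma pol_low (h : Ed m d) (N : ℕ) (hN : N < 2) (i k : Fin (m + 1)) :
    homogeneousComponent N (pol i k h) = 0 := by
  ext β
  rw [coeff_homogeneousComponent]
  split_ifs with hb
  · simp only [pol_apply, coeff_sum, coeff_monomial, coeff_zero]
    refine Finset.sum_eq_zero fun α _ => ?_
    rw [if_neg]
    rintro rfl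
    have := MIdx_mem α.2
    rw [Finsupp.degree_eq_sum] at hb
    simp at hb
    omega
  · simp

theorem Ld_top (hm : 4 ≤ m) : Ld m d = ⊤ := by
  have h0 : (Ld m d).dualCoannihilator = ⊥ := by
    rw [Submodule.eq_bot_iff]
    intro h hh
    rw [Submodule.mem_dualCoannihilator] at hh
    obtain ⟨a1, a2, a3, a4, a5⟩ := h.2
    have := Alg.inj_half hm (fun i k => pol i k h.1) a1 a2 a3 (fun N hN i k => pol_low h.1 N hN i k)
      a4 a5 (wf_of h hh)
    apply Subtype.ext
    funext i k β
    rw [← pol_coeff h.1 i k β]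
    rw [show pol i k h.1 = 0 from this i k]
    simp
  have := Subspace.dualCoannihilator_dualAnnihilator_eq (W := Ld m d)
  rw [← this, h0, Submodule.dualAnnihilator_bot]

end dual

open scoped ContDiff

section core
open MvPolynomial
variable {m d : ℕ}

def Hyp (n d : ℕ) (l₀ : Fin n) (h : Fin n → Fin n → (Fin n → ℕ) → ℝ)
    (H : Fin n → Fin n → Euc n → ℝ) : Prop :=
  (∀ i k x, H i k x = ∑ α ∈ MIdx n d, h i k α * ∏ m, x m ^ α m) ∧
  (∀ i k x, H i k x = H k i x) ∧
  (∀ x, ∑ i, H i i x = 0) ∧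
  (∀ x : Euc n, 0 ≤ x l₀ → ∀ i, H i l₀ x = 0) ∧
  (∀ x : Euc n, x l₀ = 0 → ∀ i, ∑ k, H i k x * x k = 0) ∧
  (∀ x : Euc n, x l₀ = 0 → ∀ i k, pd l₀ (H i k) x = 0)

lemma ev_pol (h : Fin (m + 1) → Fin (m + 1) → (Fin (m + 1) → ℕ) → ℝ) (i k : Fin (m + 1))
    (x : Euc (m + 1)) : ev (pol (d := d) i k (fun a b α => h a b α.1)) x =
      ∑ α ∈ MIdx (m + 1) d, h i k α * ∏ m, x m ^ α m := by
  rw [pol_apply]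
  simp only [ev, map_sum, eval_monomial]
  rw [← Finset.sum_coe_sort (MIdx (m + 1) d)]
  refine Finset.sum_congr rfl fun α _ => ?_
  rw [Finsupp.prod_fintype _ _ (by simp)]
  simp

lemma ev_snoc (q : MvPolynomial (Fin (m + 1)) ℝ)
    (hq : ∀ x : Euc (m + 1), x (Fin.last m) = 0 → ev q x = 0) : Alg.phi m q = 0 := by
  apply MvPolynomial.funext
  intro y
  rw [Alg.phi_eval, map_zero]
  have := hq (WithLp.toLp 2 (Fin.snoc (α := fun _ => ℝ) y 0)) (by simp)
  simpa [ev] using this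

lemma ev_inj {p q : MvPolynomial (Fin (m + 1)) ℝ} (h : ∀ x, ev p x = ev q x) : p = q := by
  apply MvPolynomial.funext
  intro y
  have := h (WithLp.toLp 2 y)
  simpa [ev] using this

theorem core (hm : 4 ≤ m) (d : ℕ) : ∃ C : ℝ, 0 < C ∧
    ∀ h H, Hyp (m + 1) d (Fin.last m) h H → ∀ s : ℝ, 0 < s →
      ∀ V : Fin (m + 1) → Euc (m + 1) → ℝ, (∀ i, ContDiff ℝ ∞ (V i)) →
      ∑ α ∈ MIdx (m + 1) d, ∑ i, ∑ k, h i k α ^ 2 ≤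
        C * ∫ x in Us (Fin.last m) 1, Esq (Pop s (Tten H V)) x := by
  have hc : ∀ (i k : Fin (m + 1)) (α : MIdx (m + 1) d), ∃ c : ℝ, ∀ h : Kd m d, ∀ s : ℝ, 0 < s →
      ∀ V : Fin (m + 1) → Euc (m + 1) → ℝ,
      (∀ i, ContDiff ℝ ∞ (V i)) → |h.1 i k α| ≤ c * Nn h.1 s V := by
    intro i k α
    let L : Module.Dual ℝ (Kd m d) :=
      { toFun := fun h => h.1 i k α
        map_add' := fun _ _ => rfl
        map_smul' := fun _ _ => rfl }
    have : L ∈ Ld m d := by rw [Ld_top hm]; trivial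
    exact this
  choose c hc using hc
  refine ⟨1 + ∑ α : MIdx (m + 1) d, ∑ i, ∑ k, c i k α ^ 2, by positivity, ?_⟩
  intro h H hH s hs V hV
  obtain ⟨h1, h2, h3, h4, h5, h6⟩ := hH
  set g : Ed m d := fun a b α => h a b α.1 with hg
  have hHe : ∀ i k, H i k = ev (pol i k g) := by
    intro i k; funext x; rw [h1, ev_pol]
  have hK : g ∈ Kd m d := by
    refine ⟨fun i k => ?_, ?_, fun i => ?_, fun i => ?_, fun i k => ?_⟩
    · apply ev_inj; intro x; rw [← hHe, ← hHe, h2]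
    · apply ev_inj; intro x
      have := h3 x
      simp only [hHe] at this
      simpa [ev] using this
    · apply ev_zero_of_open (Us_open (Fin.last m) 1) (Us_ne _)
      intro x hx
      rw [← hHe]; exact h4 x hx.2.2.le i
    · apply ev_snoc
      intro x hx
      have := h5 x hx i
      simp only [hHe] at this
      simpa [ev] using this
    · apply ev_snoc
      intro x hx
      rw [← ev_pd, ← hHe]; exact h6 x hx i k
  have hHH : Hh g = H := by funext i k x; unfold Hh; rw [hHe]
  have hN : Nn g s V ^ 2 = ∫ x in Us (Fin.last m) 1, Esq (Pop s (Tten H V)) x := by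
    unfold Nn
    rw [hHH, Real.sq_sqrt]
    exact integral_nonneg fun x => Esq_nonneg _ x
  rw [← hN, ← Finset.sum_coe_sort]
  have key : ∀ i k (α : MIdx (m + 1) d), h i k α ^ 2 ≤ c i k α ^ 2 * Nn g s V ^ 2 := by
    intro i k α
    have := hc i k α ⟨g, hK⟩ s hs V hV
    rw [← mul_pow, ← sq_abs]
    exact pow_le_pow_left₀ (abs_nonneg _) this 2
  calc _ ≤ ∑ α : MIdx (m + 1) d, ∑ i, ∑ k, c i k α ^ 2 * Nn g s V ^ 2 :=
        Finset.sum_le_sum fun α _ => Finset.sum_le_sum fun i _ => Finset.sum_le_sum fun k _ =>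
          key i k α
    _ = (∑ α : MIdx (m + 1) d, ∑ i, ∑ k, c i k α ^ 2) * Nn g s V ^ 2 := by
        simp only [Finset.sum_mul]
    _ ≤ _ := by nlinarith [sq_nonneg (Nn g s V)]
end core

open scoped ContDiff Pointwise
set_option linter.deprecated false

section scaling
variable {n : ℕ}

lemma smul_ap (r : ℝ) (y : Euc n) (l : Fin n) : (r • y) l = r * y l := by simp

lemma Hyp_scale {d : ℕ} {l₀ : Fin n} {h : Fin n → Fin n → (Fin n → ℕ) → ℝ}
    {H : Fin n → Fin n → Euc n → ℝ} (hH : Hyp n d l₀ h H) {r : ℝ} (hr : 0 < r) :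
    Hyp n d l₀ (fun i k α => h i k α * r ^ (∑ m, α m)) (fun i k y => H i k (r • y)) := by
  obtain ⟨h1, h2, h3, h4, h5, h6⟩ := hH
  refine ⟨fun i k x => ?_, fun i k x => h2 i k _, fun x => h3 _, fun x hx i => ?_,
    fun x hx i => ?_, fun x hx i k => ?_⟩
  · refine (h1 i k (r • x)).trans ?_
    refine Finset.sum_congr rfl fun α _ => ?_
    simp only [smul_ap, mul_pow, Finset.prod_mul_distrib, Finset.prod_pow_eq_pow_sum]
    ring
  · exact h4 _ (by rw [smul_ap]; positivity) i
  · have := h5 (r • x) (by rw [smul_ap, hx, mul_zero]) i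
    simp only [smul_ap] at this
    have e : ∑ k, H i k (r • x) * (r * x k) = r * ∑ k, H i k (r • x) * x k := by
      rw [Finset.mul_sum]; exact Finset.sum_congr rfl fun k _ => by ring
    rw [e] at this
    exact (mul_eq_zero.mp this).resolve_left hr.ne'
  · rw [pd_comp_smul, h6 _ (by rw [smul_ap, hx, mul_zero]) i k, mul_zero]

lemma ro_scale {r : ℝ} (hr : 0 < r) (ε : ℝ) (y : Euc n) :
    ro (ε / r) y = r ^ 2 * ro ε (r • y) := by
  unfold ro
  rw [norm_smul, Real.norm_eq_abs, abs_of_pos hr]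
  have : ε ^ 2 + (r * ‖y‖) ^ 2 = r ^ 2 * ((ε / r) ^ 2 + ‖y‖ ^ 2) := by field_simp
  rw [this, mul_inv, ← mul_assoc, mul_inv_cancel₀ (by positivity), one_mul]

lemma ff_scale {r : ℝ} (hr : 0 < r) (ε : ℝ) (p : Fin n) (y : Euc n) :
    ff (ε / r) p y = r * ff ε p (r • y) := by
  unfold ff
  rw [ro_scale hr, smul_ap]; ring

lemma Tten_scale {r : ℝ} (hr : 0 < r) (H : Fin n → Fin n → Euc n → ℝ) {V : Fin n → Euc n → ℝ}
    (hV : ∀ i, ContDiff ℝ ∞ (V i)) (i k : Fin n) :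
    Tten (fun i k y => H i k (r • y)) (fun i y => r⁻¹ * V i (r • y)) i k =
      fun y => Tten H V i k (r • y) := by
  have key : ∀ a b x, pd a (fun y => r⁻¹ * V b (r • y)) x = pd a (V b) (r • x) := by
    intro a b x
    have hs : ContDiff ℝ ∞ (fun y => V b (r • y)) := (hV b).comp (contDiff_const_smul r)
    rw [pd_cmul hs, pd_comp_smul]
    field_simp
  funext y
  unfold Tten Sop
  simp only [key]

lemma Pop_scale {r : ℝ} (hr : 0 < r) (ε : ℝ) (H : Fin n → Fin n → Euc n → ℝ)
    {V : Fin n → Euc n → ℝ} (hV : ∀ i, ContDiff ℝ ∞ (V i)) (i k l : Fin n) (y : Euc n) :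
    Pop (ε / r) (Tten (fun i k y => H i k (r • y)) (fun i y => r⁻¹ * V i (r • y))) i k l y =
      r * Pop ε (Tten H V) i k l (r • y) := by
  unfold Pop
  simp only [Tten_scale hr H hV, pd_comp_smul, ff_scale hr, mul_assoc, ← Finset.mul_sum]
  ring

lemma Us_scale (l₀ : Fin n) {r : ℝ} (hr : 0 < r) : r • Us l₀ 1 = Us l₀ r := by
  ext x
  rw [Set.mem_smul_set_iff_inv_smul_mem₀ hr.ne']
  simp only [Us, Set.mem_setOf_eq, norm_smul, norm_inv, Real.norm_eq_abs, abs_of_pos hr, smul_ap]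
  rw [inv_mul_eq_div, lt_div_iff₀ hr, div_lt_iff₀ hr, inv_mul_eq_div, div_pos_iff_of_pos_right hr]
  constructor <;> rintro ⟨a, b, c⟩ <;> exact ⟨by linarith, by linarith, c⟩

lemma int_scale (l₀ : Fin n) {r : ℝ} (hr : 0 < r) (ε : ℝ) (H : Fin n → Fin n → Euc n → ℝ)
    {V : Fin n → Euc n → ℝ} (hV : ∀ i, ContDiff ℝ ∞ (V i)) :
    ∫ y in Us l₀ 1, Esq (Pop (ε / r) (Tten (fun i k y => H i k (r • y))
      (fun i y => r⁻¹ * V i (r • y)))) y = r ^ 2 * (r ^ n)⁻¹ *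
      ∫ x in Us l₀ r, Esq (Pop ε (Tten H V)) x := by
  have e : ∀ y, Esq (Pop (ε / r) (Tten (fun i k y => H i k (r • y))
      (fun i y => r⁻¹ * V i (r • y)))) y = r ^ 2 * Esq (Pop ε (Tten H V)) (r • y) := by
    intro y
    unfold Esq
    simp only [Pop_scale hr ε H hV, mul_pow, Finset.mul_sum]
  simp only [e]
  rw [integral_const_mul, Measure.setIntegral_comp_smul_of_pos volume
    (fun x => Esq (Pop ε (Tten H V)) x) _ hr, Us_scale l₀ hr]
  simp [mul_assoc]
end scaling

section ann
variable {N : ℕ}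

lemma Hyp_sm {n d : ℕ} {l₀ : Fin n} {h : Fin n → Fin n → (Fin n → ℕ) → ℝ}
    {H : Fin n → Fin n → Euc n → ℝ} (hH : Hyp n d l₀ h H) (i k : Fin n) :
    ContDiff ℝ ∞ (H i k) := by
  have : H i k = fun x => ∑ α ∈ MIdx n d, h i k α * ∏ m, x m ^ α m := by
    funext x; exact hH.1 i k x
  rw [this]
  exact ContDiff.sum fun α _ => contDiff_const.mul (contDiff_prod fun m _ => (coord_sm m).pow _)

lemma uE_sq {ε : ℝ} (he : 0 < ε) (x : Euc (N + 2)) :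
    uE (N + 2) ε x ^ 2 = (ε / (ε ^ 2 + ‖x‖ ^ 2)) ^ N := by
  have := den_pos he x
  unfold uE
  set a := ε / (ε ^ 2 + ‖x‖ ^ 2)
  have ha : 0 ≤ a := by positivity
  rw [← Real.rpow_natCast a N, ← Real.rpow_natCast _ 2, ← Real.rpow_mul ha]
  congr 1
  push_cast; ring

lemma Esq_Q {ε : ℝ} (he : 0 < ε) (hN : 1 ≤ N) (H : Fin (N + 2) → Fin (N + 2) → Euc (N + 2) → ℝ)
    (V : Fin (N + 2) → Euc (N + 2) → ℝ) (x : Euc (N + 2)) :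
    Esq (Qop ε H V) x = (ε / (ε ^ 2 + ‖x‖ ^ 2)) ^ N * Esq (Pop ε (Tten H V)) x := by
  unfold Esq
  simp only [Q_eq (show 3 ≤ N + 2 by omega) he, mul_pow, Finset.mul_sum, uE_sq he]

lemma Q_cont {ε : ℝ} (he : 0 < ε) (hN : 1 ≤ N) {H : Fin (N + 2) → Fin (N + 2) → Euc (N + 2) → ℝ}
    {V : Fin (N + 2) → Euc (N + 2) → ℝ} (hH : ∀ i k, ContDiff ℝ ∞ (H i k))
    (hV : ∀ i, ContDiff ℝ ∞ (V i)) : Continuous (Esq (Qop ε H V)) := by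
  have : Esq (Qop ε H V) = fun x => (ε / (ε ^ 2 + ‖x‖ ^ 2)) ^ N * Esq (Pop ε (Tten H V)) x := by
    funext x; exact Esq_Q he hN H V x
  rw [this]
  refine Continuous.mul ((continuous_const.div (den_sm ε).continuous
    fun x => (den_pos he x).ne').pow N) ?_
  exact Esq_cont fun i k l => (Pop_sm he (Tten_sm hH hV) i k l).continuous

theorem ann (hN : 3 ≤ N) (d : ℕ) : ∃ C : ℝ, 0 < C ∧
    ∀ h H, Hyp (N + 2) d (Fin.last (N + 1)) h H → ∀ ε : ℝ, 0 < ε →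
      ∀ V : Fin (N + 2) → Euc (N + 2) → ℝ, (∀ i, ContDiff ℝ ∞ (V i)) → ∀ r : ℝ, ε ≤ r →
      ε ^ N * ∑ α ∈ MIdx (N + 2) d, ∑ i, ∑ k, h i k α ^ 2 * r ^ (2 * ∑ m, α m) ≤
        C * (r ^ N * ∫ x in Us (Fin.last (N + 1)) r, Esq (Qop ε H V) x) := by
  obtain ⟨C, hC, hc⟩ := core (m := N + 1) (by omega) d
  refine ⟨C * 2 ^ N, by positivity, ?_⟩
  intro h H hH ε he V hV r hr
  have hr0 : 0 < r := he.trans_le hr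
  have h1 := hc _ _ (Hyp_scale hH hr0) (ε / r) (by positivity) (fun i y => r⁻¹ * V i (r • y))
    (fun i => contDiff_const.mul ((hV i).comp (contDiff_const_smul r)))
  rw [int_scale _ hr0 ε H hV] at h1
  have h2 : ∫ x in Us (Fin.last (N + 1)) r, Esq (Pop ε (Tten H V)) x ≤
      ∫ x in Us (Fin.last (N + 1)) r, (2 * r ^ 2 / ε) ^ N * Esq (Qop ε H V) x := by
    refine setIntegral_mono_on (cont_int (Us_sub _ r) (Esq_cont fun i k l =>
      (Pop_sm he (Tten_sm (Hyp_sm hH) hV) i k l).continuous))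
      (cont_int (Us_sub _ r) (continuous_const.mul (Q_cont he (by omega) (Hyp_sm hH) hV)))
      (Us_open _ r).measurableSet ?_
    intro x hx
    rw [Esq_Q he (by omega), ← mul_assoc, ← mul_pow]
    have hb : 1 ≤ 2 * r ^ 2 / ε * (ε / (ε ^ 2 + ‖x‖ ^ 2)) := by
      have := den_pos he x
      rw [div_mul_div_comm, le_div_iff₀ (by positivity)]
      have : ‖x‖ ^ 2 ≤ r ^ 2 := pow_le_pow_left₀ (norm_nonneg _) hx.2.1.le 2
      have : ε ^ 2 ≤ r ^ 2 := pow_le_pow_left₀ he.le hr 2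
      nlinarith
    exact le_mul_of_one_le_left (Esq_nonneg _ x) (one_le_pow₀ hb)
  rw [integral_const_mul] at h2
  have e1 : ∑ α ∈ MIdx (N + 2) d, ∑ i, ∑ k, (h i k α * r ^ (∑ m, α m)) ^ 2 =
      ∑ α ∈ MIdx (N + 2) d, ∑ i, ∑ k, h i k α ^ 2 * r ^ (2 * ∑ m, α m) := by
    refine Finset.sum_congr rfl fun α _ => Finset.sum_congr rfl fun i _ =>
      Finset.sum_congr rfl fun k _ => ?_
    rw [mul_pow, ← pow_mul, mul_comm 2]
  set A := ∑ α ∈ MIdx (N + 2) d, ∑ i, ∑ k, h i k α ^ 2 * r ^ (2 * ∑ m, α m)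
  set I := ∫ x in Us (Fin.last (N + 1)) r, Esq (Qop ε H V) x
  have h1' : A ≤ C * (r ^ 2 * (r ^ (N + 2))⁻¹ * ((2 * r ^ 2 / ε) ^ N * I)) := by
    rw [← e1]
    refine h1.trans ?_
    gcongr
  calc ε ^ N * A ≤ ε ^ N * (C * (r ^ 2 * (r ^ (N + 2))⁻¹ * ((2 * r ^ 2 / ε) ^ N * I))) := by gcongr
    _ = _ := by
      rw [div_pow, mul_pow, ← pow_mul, pow_add]
      field_simp
      ring
end ann

open scoped ContDiff

section final
variable {N : ℕ}

lemma MIdx_le {n d : ℕ} {α : Fin n → ℕ} (h : α ∈ MIdx n d) : ∑ i, α i ≤ d := by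
  unfold MIdx at h
  exact (Finset.mem_filter.mp h).2.2

lemma wt_cont {ε : ℝ} (he : 0 < ε) (e : ℝ) : Continuous (fun x : Euc (N + 2) => (ε + ‖x‖) ^ e) :=
  (continuous_const.add continuous_norm).rpow_const fun x => Or.inl (add_pos_of_pos_of_nonneg he (norm_nonneg x)).ne'

lemma int_part {ε δ : ℝ} (he : 0 < ε) (hδ : 0 < δ) {A : Set (Euc (N + 2))} (hA : MeasurableSet A)
    (hAb : A ⊆ ball 0 δ) (hx : ∀ x ∈ A, δ / 4 ≤ ε + ‖x‖) (a : ℕ) (ha : 2 * a ≤ N) :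
    ∫ x in A, (ε + ‖x‖) ^ (2 * (a : ℝ) + 2 - 2 * ((N + 2 : ℕ) : ℝ)) ≤
      4 ^ (2 * (N + 2)) * volume.real (ball (0 : Euc (N + 2)) 1) * (δ ^ (2 * a) * (δ ^ N)⁻¹) := by
  set e : ℝ := 2 * (a : ℝ) + 2 - 2 * ((N + 2 : ℕ) : ℝ) with hed
  have ha' : 2 * (a : ℝ) ≤ N := by exact_mod_cast ha
  have he0 : e ≤ 0 := by rw [hed]; push_cast; linarith
  have he1 : -e ≤ ((2 * (N + 2) : ℕ) : ℝ) := by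
    rw [hed]; push_cast; linarith [(Nat.cast_nonneg a : (0 : ℝ) ≤ a)]
  have hsub : A ⊆ closedBall 0 δ := hAb.trans ball_subset_closedBall
  have hAf : volume A ≠ ⊤ :=
    (lt_of_le_of_lt (measure_mono hsub) (isCompact_closedBall 0 δ).measure_lt_top).ne
  have p1 : ∀ x ∈ A, (ε + ‖x‖) ^ e ≤ 4 ^ (2 * (N + 2)) * δ ^ e := by
    intro x hxA
    calc (ε + ‖x‖) ^ e ≤ (δ / 4) ^ e := Real.rpow_le_rpow_of_nonpos (by positivity) (hx x hxA) he0
      _ = (4 : ℝ) ^ (-e) * δ ^ e := by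
          rw [Real.div_rpow hδ.le (by norm_num), Real.rpow_neg (by norm_num)]
          field_simp
      _ ≤ _ := by
          gcongr
          rw [← Real.rpow_natCast]
          exact Real.rpow_le_rpow_of_exponent_le (by norm_num) he1
  have p2 : ∫ x in A, (ε + ‖x‖) ^ e ≤ ∫ x in A, (4 : ℝ) ^ (2 * (N + 2)) * δ ^ e :=
    setIntegral_mono_on (cont_int hsub (wt_cont he e)) (cont_int hsub continuous_const) hA p1
  rw [setIntegral_const, smul_eq_mul] at p2
  have p3 : volume.real A ≤ δ ^ (N + 2) * volume.real (ball (0 : Euc (N + 2)) 1) := by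
    have := congrArg ENNReal.toReal
      (Measure.addHaar_ball_of_pos (volume : Measure (Euc (N + 2))) 0 hδ)
    rw [finrank_euclideanSpace_fin, ENNReal.toReal_mul,
      ENNReal.toReal_ofReal (by positivity), ← measureReal_def, ← measureReal_def] at this
    rw [← this]
    exact measureReal_mono hAb measure_ball_lt_top.ne
  have p4 : δ ^ e * δ ^ (N + 2) = δ ^ (2 * a) * (δ ^ N)⁻¹ := by
    rw [← Real.rpow_natCast, ← Real.rpow_natCast, ← Real.rpow_natCast, ← Real.rpow_neg hδ.le,
      ← Real.rpow_add hδ, ← Real.rpow_add hδ]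
    congr 1
    rw [hed]; push_cast; ring
  calc _ ≤ _ := p2
    _ ≤ δ ^ (N + 2) * volume.real (ball (0 : Euc (N + 2)) 1) * (4 ^ (2 * (N + 2)) * δ ^ e) := by
        gcongr
    _ = _ := by rw [← p4]; ring

def Sd (N : ℕ) (δ : ℝ) : Set (Euc (N + 2)) := ball 0 δ ∩ {x | 0 ≤ x (Fin.last (N + 1))}

lemma Sd_meas (δ : ℝ) : MeasurableSet (Sd N δ) :=
  measurableSet_ball.inter (isClosed_le continuous_const (cc _)).measurableSet

def Ff (d : ℕ) (h : Fin (N + 2) → Fin (N + 2) → (Fin (N + 2) → ℕ) → ℝ) (ε : ℝ)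
    (A : Set (Euc (N + 2))) : ℝ :=
  ∑ α ∈ MIdx (N + 2) d, ∑ i, ∑ k, h i k α ^ 2 * ε ^ (((N + 2 : ℕ) : ℝ) - 2) *
    ∫ x in A, (ε + ‖x‖) ^ (2 * (∑ m, (α m : ℝ)) + 2 - 2 * ((N + 2 : ℕ) : ℝ))

theorem main (hN : 3 ≤ N) {d : ℕ} (hd : 2 * d ≤ N) : ∃ K : ℝ, 0 < K ∧
    ∀ h H, Hyp (N + 2) d (Fin.last (N + 1)) h H → ∀ ε : ℝ, 0 < ε →
      ∀ V : Fin (N + 2) → Euc (N + 2) → ℝ, (∀ i, ContDiff ℝ ∞ (V i)) → ∀ δ : ℝ, 2 * ε ≤ δ →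
      Ff d h ε (Sd N δ) ≤ K * ∫ x in Sd N δ, Esq (Qop ε H V) x := by
  obtain ⟨C, hC, hc⟩ := ann hN d
  set v := volume.real (ball (0 : Euc (N + 2)) 1) with hv
  have hv0 : 0 < v :=
    ENNReal.toReal_pos (measure_ball_pos volume _ one_pos).ne' measure_ball_lt_top.ne
  refine ⟨4 ^ (2 * (N + 2)) * v * C, by positivity, ?_⟩
  intro h H hH ε he V hV
  set K := 4 ^ (2 * (N + 2)) * v * C with hK
  have hK0 : 0 < K := by positivity
  have qc := Q_cont he (by omega) (Hyp_sm hH) hV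
  have part : ∀ δ, 2 * ε ≤ δ → ∀ A : Set (Euc (N + 2)), MeasurableSet A → A ⊆ ball 0 δ →
      (∀ x ∈ A, δ / 4 ≤ ε + ‖x‖) →
      Ff d h ε A ≤ K * ∫ x in Us (Fin.last (N + 1)) δ, Esq (Qop ε H V) x := by
    intro δ hδ A hA hAb hx
    have hδ0 : 0 < δ := by linarith
    have hann := hc h H hH ε he V hV δ (by linarith)
    have eN : ε ^ (((N + 2 : ℕ) : ℝ) - 2) = ε ^ N := by
      rw [← Real.rpow_natCast]; congr 1; push_cast; ring
    calc Ff d h ε A ≤ ∑ α ∈ MIdx (N + 2) d, ∑ i, ∑ k, h i k α ^ 2 * ε ^ N *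
          (4 ^ (2 * (N + 2)) * v * (δ ^ (2 * ∑ m, α m) * (δ ^ N)⁻¹)) := by
          unfold Ff
          refine Finset.sum_le_sum fun α hα => Finset.sum_le_sum fun i _ =>
            Finset.sum_le_sum fun k _ => ?_
          rw [eN]
          have := int_part he hδ0 hA hAb hx (∑ m, α m) (by have := MIdx_le hα; omega)
          push_cast at this ⊢
          exact mul_le_mul_of_nonneg_left this (by positivity)
      _ = 4 ^ (2 * (N + 2)) * v * (δ ^ N)⁻¹ *
          (ε ^ N * ∑ α ∈ MIdx (N + 2) d, ∑ i, ∑ k, h i k α ^ 2 * δ ^ (2 * ∑ m, α m)) := by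
          simp only [Finset.mul_sum]
          refine Finset.sum_congr rfl fun α _ => Finset.sum_congr rfl fun i _ =>
            Finset.sum_congr rfl fun k _ => ?_
          ring
      _ ≤ 4 ^ (2 * (N + 2)) * v * (δ ^ N)⁻¹ *
          (C * (δ ^ N * ∫ x in Us (Fin.last (N + 1)) δ, Esq (Qop ε H V) x)) := by gcongr
      _ = _ := by rw [hK]; field_simp
  have usub : ∀ δ, Us (Fin.last (N + 1)) δ ⊆ Sd N δ := fun δ x hx =>
    ⟨by simpa using hx.2.1, hx.2.2.le⟩
  have sb : ∀ δ, Sd N δ ⊆ closedBall 0 δ := fun δ =>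
    Set.inter_subset_left.trans ball_subset_closedBall
  have main : ∀ j : ℕ, ∀ δ, 2 * ε ≤ δ → δ < 2 ^ (j + 2) * ε →
      Ff d h ε (Sd N δ) ≤ K * ∫ x in Sd N δ, Esq (Qop ε H V) x := by
    intro j
    induction j with
    | zero =>
      intro δ h1 h2
      refine (part δ h1 (Sd N δ) (Sd_meas δ) Set.inter_subset_left fun x _ => ?_).trans ?_
      · norm_num at h2
        linarith [norm_nonneg x]
      · refine mul_le_mul_of_nonneg_left ?_ hK0.le
        exact setIntegral_mono_set (cont_int (sb δ) qc)
          (Filter.Eventually.of_forall fun x => Esq_nonneg _ x) (usub δ).eventuallyLE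
    | succ j ih =>
      intro δ h1 h2
      rcases lt_or_ge δ (4 * ε) with h3 | h3
      · refine (part δ h1 (Sd N δ) (Sd_meas δ) Set.inter_subset_left fun x _ => ?_).trans ?_
        · linarith [norm_nonneg x]
        · refine mul_le_mul_of_nonneg_left ?_ hK0.le
          exact setIntegral_mono_set (cont_int (sb δ) qc)
            (Filter.Eventually.of_forall fun x => Esq_nonneg _ x) (usub δ).eventuallyLE
      have hδ0 : 0 < δ := by linarith
      have i1 := ih (δ / 2) (by linarith) (by rw [pow_succ] at h2; linarith)
      have i2 := part δ h1 (Sd N δ \ Sd N (δ / 2)) ((Sd_meas δ).diff (Sd_meas _))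
        (Set.diff_subset.trans Set.inter_subset_left) (by
          rintro x ⟨⟨hx1, hx2⟩, hx3⟩
          have : δ / 2 ≤ ‖x‖ := by
            by_contra hlt
            exact hx3 ⟨by simpa using hlt, hx2⟩
          linarith)
      have ss : Sd N (δ / 2) ⊆ Sd N δ :=
        Set.inter_subset_inter_left _ (ball_subset_ball (by linarith))
      have i3 : Ff d h ε (Sd N δ) = Ff d h ε (Sd N (δ / 2)) + Ff d h ε (Sd N δ \ Sd N (δ / 2)) := by
        unfold Ff
        simp only [← Finset.sum_add_distrib]
        refine Finset.sum_congr rfl fun α _ => Finset.sum_congr rfl fun i _ =>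
          Finset.sum_congr rfl fun k _ => ?_
        rw [← mul_add]
        congr 1
        have hw := cont_int (sb δ) (wt_cont he
          (2 * (∑ m, (α m : ℝ)) + 2 - 2 * ((N + 2 : ℕ) : ℝ)))
        rw [setIntegral_diff (Sd_meas _) hw ss]
        ring
      have i4 : (∫ x in Sd N (δ / 2), Esq (Qop ε H V) x) +
          ∫ x in Us (Fin.last (N + 1)) δ, Esq (Qop ε H V) x ≤ ∫ x in Sd N δ, Esq (Qop ε H V) x := by
        rw [← setIntegral_union _ (Us_open _ δ).measurableSet (cont_int (sb _) qc)
          (cont_int (Us_sub _ δ) qc)]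
        · exact setIntegral_mono_set (cont_int (sb δ) qc)
            (Filter.Eventually.of_forall fun x => Esq_nonneg _ x)
            (Set.union_subset ss (usub δ)).eventuallyLE
        · rw [Set.disjoint_left]
          rintro x ⟨hx1, _⟩ hx2
          have := hx2.1
          simp at hx1
          linarith
      calc _ = _ := i3
        _ ≤ _ := add_le_add i1 i2
        _ = K * ((∫ x in Sd N (δ / 2), Esq (Qop ε H V) x) +
          ∫ x in Us (Fin.last (N + 1)) δ, Esq (Qop ε H V) x) := by ring
        _ ≤ _ := mul_le_mul_of_nonneg_left i4 hK0.le
  intro δ hδ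
  obtain ⟨j, hj⟩ := pow_unbounded_of_one_lt (δ / ε) (one_lt_two (α := ℝ))
  refine main j δ hδ ?_
  rw [div_lt_iff₀ he] at hj
  refine hj.trans_le ?_
  gcongr
  · norm_num
  · omega
end final

/-- There exists `K₄ > 0`, depending only on `n`, such that for every `H` as in the
context, every `ε > 0`, every smooth vector field `V` on `ℝ^n_+` and every `δ ≥ 2ε`:
`Σ |h_{ik,α}|² ε^{n-2} ∫_{B_δ ∩ ℝ^n_+} (ε+|x|)^{2|α|+2-2n} ≤ K₄ ∫_{B_δ ∩ ℝ^n_+} Σ |Q_{ik,l}|²`. -/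
theorem statement6 (n : ℕ) (hn : 6 ≤ n) (l₀ : Fin n) (hl₀ : (l₀ : ℕ) = n - 1)
    (d : ℕ) (hd : d = (n - 2) / 2) :
    ∃ K₄ : ℝ, 0 < K₄ ∧
      ∀ (h : Fin n → Fin n → (Fin n → ℕ) → ℝ) (H : Fin n → Fin n → Euc n → ℝ),
        (∀ i k x, H i k x = ∑ α ∈ MIdx n d, h i k α * ∏ m, x m ^ α m) →
        (∀ i k x, H i k x = H k i x) →
        (∀ x, ∑ i, H i i x = 0) →
        (∀ x : Euc n, 0 ≤ x l₀ → ∀ i, H i l₀ x = 0) →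
        (∀ x : Euc n, x l₀ = 0 → ∀ i, ∑ k, H i k x * x k = 0) →
        (∀ x : Euc n, x l₀ = 0 → ∀ i k, pd l₀ (H i k) x = 0) →
        ∀ ε : ℝ, 0 < ε →
        ∀ V : Fin n → Euc n → ℝ, (∀ i, ContDiff ℝ (⊤ : ℕ∞) (V i)) →
        ∀ δ : ℝ, 2 * ε ≤ δ →
          ∑ α ∈ MIdx n d, ∑ i, ∑ k,
              (h i k α) ^ 2 * ε ^ ((n : ℝ) - 2)
                * ∫ x in Metric.ball (0 : Euc n) δ ∩ {x : Euc n | 0 ≤ x l₀},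
                    (ε + ‖x‖) ^ (2 * (∑ m, (α m : ℝ)) + 2 - 2 * (n : ℝ))
            ≤ K₄ * ∫ x in Metric.ball (0 : Euc n) δ ∩ {x : Euc n | 0 ≤ x l₀},
                ∑ i, ∑ k, ∑ l, (Qop ε H V i k l x) ^ 2 := by
  obtain ⟨N, rfl⟩ : ∃ N, n = N + 2 := ⟨n - 2, by omega⟩
  have hl : l₀ = Fin.last (N + 1) := by
    apply Fin.ext
    rw [hl₀, Fin.val_last]
    omega
  subst hl
  obtain ⟨K, hK, hmain⟩ := main (N := N) (d := d) (by omega) (by omega)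
  refine ⟨K, hK, ?_⟩
  intro h H h1 h2 h3 h4 h5 h6 ε he V hV δ hδ
  exact hmain h H ⟨h1, h2, h3, h4, h5, h6⟩ ε he V hV δ hδ
end
end

section
/- Let n ≥ 2 and let φ: ℝ^n → ℝ be a polynomial which is homogeneous of degree d' ≥ 2 and satisfies: ∂_n∂_n φ(x) = −(1/(n−1)) Σ_{i=1}^{n−1} ∂_i∂_i φ(x) for all x ∈ ℝ^n_+; φ(x) = 0 for all x ∈ ∂ℝ^n_+; and ∂_n φ(x) = 0 for all x ∈ ∂ℝ^n_+. Then φ(x) = 0 for all x ∈ ℝ^n_+. -/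
noncomputable section

open MeasureTheory Metric

open MvPolynomial in
lemma aux_fderiv {n : ℕ} (G : MvPolynomial (Fin n) ℝ) (x : Euc n) :
    ∃ L : Euc n →L[ℝ] ℝ, HasFDerivAt (fun y : Euc n => eval (fun i => y i) G) L x ∧
      ∀ i, L (EuclideanSpace.single i 1) = eval (fun i => x i) (pderiv i G) := by
  induction G using MvPolynomial.induction_on with
  | C a => exact ⟨0, by simpa using hasFDerivAt_const a x, by simp⟩
  | add p q hp hq =>
    obtain ⟨L, hL, hL'⟩ := hp
    obtain ⟨M, hM, hM'⟩ := hq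
    exact ⟨L + M, by simp only [map_add]; exact hL.add hM, fun i => by simp [hL', hM']⟩
  | mul_X p j hp =>
    obtain ⟨L, hL, hL'⟩ := hp
    have h1 : HasFDerivAt (fun y : Euc n => y j)
      (EuclideanSpace.proj j : Euc n →L[ℝ] ℝ) x :=
      (EuclideanSpace.proj j : Euc n →L[ℝ] ℝ).hasFDerivAt
    refine ⟨_, by simp only [map_mul, eval_X]; exact hL.mul h1, fun i => ?_⟩
    rw [Derivation.leibniz]
    by_cases h : i = j
    · subst h
      simp [hL']
    · simp [hL', pderiv_X_of_ne (Ne.symm h), Ne.symm h]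

open MvPolynomial in
lemma aux_pd {n : ℕ} (G : MvPolynomial (Fin n) ℝ) (i : Fin n) :
    pd i (fun y : Euc n => eval (fun i => y i) G)
      = fun y : Euc n => eval (fun i => y i) (pderiv i G) := by
  funext x
  obtain ⟨L, hL, hL'⟩ := aux_fderiv G x
  rw [pd, hL.fderiv, hL']

def lineP {n : ℕ} (y : Fin n → ℝ) (i : Fin n) (G : MvPolynomial (Fin n) ℝ) : Polynomial ℝ :=
  MvPolynomial.aeval (Function.update (fun j => Polynomial.C (y j)) i Polynomial.X) G

lemma lineP_eval {n : ℕ} (y : Fin n → ℝ) (i : Fin n) (G : MvPolynomial (Fin n) ℝ) (t : ℝ) :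
    (lineP y i G).eval t = MvPolynomial.eval (Function.update y i t) G := by
  unfold lineP
  induction G using MvPolynomial.induction_on with
  | C a => simp
  | add p q hp hq => simp [hp, hq]
  | mul_X p j hp =>
    by_cases h : j = i
    · subst h
      simp [hp]
    · simp [hp, h]

lemma lineP_deriv {n : ℕ} (y : Fin n → ℝ) (i : Fin n) (G : MvPolynomial (Fin n) ℝ) :
    Polynomial.derivative (lineP y i G) = lineP y i (MvPolynomial.pderiv i G) := by
  unfold lineP
  induction G using MvPolynomial.induction_on with
  | C a => simp
  | add p q hp hq => simp [hp, hq]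
  | mul_X p j hp =>
    rw [Derivation.leibniz]
    by_cases h : j = i
    · subst h
      simp [hp]
      ring
    · simp [hp, h, MvPolynomial.pderiv_X_of_ne h]
      ring

lemma lineP_iter {n : ℕ} (y : Fin n → ℝ) (i : Fin n) (G : MvPolynomial (Fin n) ℝ) (k : ℕ) :
    Polynomial.derivative^[k] (lineP y i G)
      = lineP y i ((fun H => MvPolynomial.pderiv i H)^[k] G) := by
  induction k with
  | zero => rfl
  | succ k ih => rw [Function.iterate_succ_apply', Function.iterate_succ_apply', ih, lineP_deriv]

lemma aux_comm {n : ℕ} (l i : Fin n) (G : MvPolynomial (Fin n) ℝ) :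
    MvPolynomial.pderiv l (MvPolynomial.pderiv i G)
      = MvPolynomial.pderiv i (MvPolynomial.pderiv l G) := by
  have h : ⁅(MvPolynomial.pderiv l : Derivation ℝ (MvPolynomial (Fin n) ℝ) (MvPolynomial (Fin n) ℝ)),
      (MvPolynomial.pderiv i : Derivation ℝ (MvPolynomial (Fin n) ℝ) (MvPolynomial (Fin n) ℝ))⁆ = 0 := by
    apply MvPolynomial.derivation_ext
    intro j
    rw [Derivation.commutator_apply]
    simp only [MvPolynomial.pderiv_X, Pi.single_apply]
    split_ifs <;> simp
  have h2 := congrArg (fun D => D G) h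
  simpa [Derivation.commutator_apply, sub_eq_zero] using h2

lemma tang {n : ℕ} (l i : Fin n) (hil : i ≠ l) (G : MvPolynomial (Fin n) ℝ)
    (hG : ∀ y : Fin n → ℝ, y l = 0 → MvPolynomial.eval y G = 0) (y : Fin n → ℝ) (hy : y l = 0) :
    MvPolynomial.eval y (MvPolynomial.pderiv i G) = 0 := by
  have h0 : lineP y i G = 0 := by
    apply Polynomial.funext
    intro t
    rw [lineP_eval, Polynomial.eval_zero]
    exact hG _ (by rw [Function.update_of_ne hil.symm, hy])
  have h1 := lineP_eval y i (MvPolynomial.pderiv i G) (y i)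
  rw [← lineP_deriv, h0, Function.update_eq_self] at h1
  simpa using h1.symm

lemma main_poly {n : ℕ} (l : Fin n) (c : ℝ) (P : MvPolynomial (Fin n) ℝ)
    (hQ : MvPolynomial.pderiv l (MvPolynomial.pderiv l P)
      = MvPolynomial.C c * ∑ i ∈ Finset.univ.erase l,
        MvPolynomial.pderiv i (MvPolynomial.pderiv i P))
    (h0 : ∀ y : Fin n → ℝ, y l = 0 → MvPolynomial.eval y P = 0)
    (h1 : ∀ y : Fin n → ℝ, y l = 0 → MvPolynomial.eval y (MvPolynomial.pderiv l P) = 0)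
    (y : Fin n → ℝ) : MvPolynomial.eval y P = 0 := by
  have key : ∀ k, ∀ G : MvPolynomial (Fin n) ℝ, 
      MvPolynomial.pderiv l (MvPolynomial.pderiv l G)
      = MvPolynomial.C c * ∑ i ∈ Finset.univ.erase l,
        MvPolynomial.pderiv i (MvPolynomial.pderiv i G) →
      (∀ y : Fin n → ℝ, y l = 0 → MvPolynomial.eval y G = 0) →
      (∀ y : Fin n → ℝ, y l = 0 → MvPolynomial.eval y (MvPolynomial.pderiv l G) = 0) →
      ∀ y : Fin n → ℝ, y l = 0 →
        MvPolynomial.eval y ((fun H => MvPolynomial.pderiv l H)^[k] G) = 0 := by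
    intro k
    induction k with
    | zero => intro G _ h _; exact h
    | succ k ih =>
      intro G hG g0 g1
      rw [Function.iterate_succ_apply]
      refine ih _ ?_ g1 ?_
      · have := congrArg (MvPolynomial.pderiv l) hG
        rw [this, MvPolynomial.pderiv_C_mul, map_sum]
        congr 1
        refine Finset.sum_congr rfl fun i _ => ?_
        rw [aux_comm l i, aux_comm l i]
      · intro y hy
        rw [hG, map_mul, map_sum, Finset.sum_eq_zero, mul_zero]
        intro i hi
        have hil := Finset.ne_of_mem_erase hi
        exact tang l i hil _ (tang l i hil _ g0) y hy
  have hz : lineP y l P = 0 := by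
    ext k
    have h := key k P hQ h0 h1 (Function.update y l 0) (by simp)
    rw [← lineP_eval, ← lineP_iter, ← Polynomial.coeff_zero_eq_eval_zero,
      Polynomial.coeff_iterate_derivative, zero_add, Nat.descFactorial_self, nsmul_eq_mul] at h
    have hk : (k.factorial : ℝ) ≠ 0 := by exact_mod_cast k.factorial_ne_zero
    simpa [hk] using h
  have h := lineP_eval y l P (y l)
  rw [hz, Function.update_eq_self] at h
  simpa using h.symm

/-- a homogeneous polynomial of degree `d' ≥ 2` on `ℝ^n` satisfying
`∂_n∂_n φ = -(1/(n-1)) Σ_{i<n} ∂_i∂_i φ` on `ℝ^n_+` and vanishing together with its normal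
derivative on `∂ℝ^n_+` vanishes identically on `ℝ^n_+`. -/
theorem statement16 (n : ℕ) (hn : 2 ≤ n) (l₀ : Fin n) (hl₀ : (l₀ : ℕ) = n - 1)
    (d' : ℕ) (hd' : 2 ≤ d')
    (φ : Euc n → ℝ)
    (hpoly : ∃ P : MvPolynomial (Fin n) ℝ,
      ∀ x : Euc n, φ x = MvPolynomial.eval (fun i => x i) P)
    (hhom : ∀ (t : ℝ) (x : Euc n), φ (t • x) = t ^ d' * φ x)
    (hPDE : ∀ x : Euc n, 0 ≤ x l₀ →
      pd l₀ (pd l₀ φ) x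
        = -(1 / ((n : ℝ) - 1)) * ∑ i ∈ Finset.univ.erase l₀, pd i (pd i φ) x)
    (hb0 : ∀ x : Euc n, x l₀ = 0 → φ x = 0)
    (hb1 : ∀ x : Euc n, x l₀ = 0 → pd l₀ φ x = 0) :
    ∀ x : Euc n, 0 ≤ x l₀ → φ x = 0 := by
  obtain ⟨P, hP⟩ := hpoly
  obtain rfl : φ = fun y : Euc n => MvPolynomial.eval (fun i => y i) P := funext hP
  simp only [aux_pd] at hPDE hb1
  intro x _
  refine main_poly l₀ (-(1 / ((n : ℝ) - 1))) P ?_ (fun y hy => hb0 (WithLp.toLp 2 y) hy)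
    (fun y hy => hb1 (WithLp.toLp 2 y) hy) _
  refine MvPolynomial.funext_set (fun _ => Set.Ici (0 : ℝ)) (fun _ => Set.Ici_infinite _) ?_
  intro y hy
  have h := hPDE (WithLp.toLp 2 y) (hy l₀ (Set.mem_univ _))
  simpa using h
end
end

section
/- For x ∈ ∂ℝ^n_+ and i,k ∈ {1,…,n−1}, define Â_{ik}(x) = Σ_{m=1}^{n−1} ∂_i∂_m H_{mk}(x) + Σ_{m=1}^{n−1} ∂_m∂_k H_{im}(x) − Σ_{m=1}^{n−1} ∂_m∂_m H_{ik}(x) − (1/(n−2)) Σ_{m,p=1}^n ∂_m∂_p H_{mp}(x) δ_{ik}. Assume that Z_{inkn}(x) = 0 for all x ∈ ∂ℝ^n_+ and all i,k ∈ {1,…,n−1}. Then Â_{ik}(x) = ((n−3)/(n−2)) A_{ik}(x) for all x ∈ ∂ℝ^n_+ and all i,k ∈ {1,…,n−1}. -/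
noncomputable section

open MeasureTheory Metric

/-- The tensor `A_{ik}` associated to a symmetric two-tensor field `H`. -/
def Aop {n : ℕ} (H : Fin n → Fin n → Euc n → ℝ) (i k : Fin n) : Euc n → ℝ :=
  fun x =>
    (∑ m, pd i (pd m (H m k)) x) + (∑ m, pd m (pd k (H i m)) x)
      - (∑ m, pd m (pd m (H i k)) x)
      - (1 / ((n : ℝ) - 1)) * (∑ m, ∑ p, pd m (pd p (H m p)) x) * kd i k

/-- The tensor `Z_{ijkl}` associated to a symmetric two-tensor field `H`. -/
def Zop {n : ℕ} (H : Fin n → Fin n → Euc n → ℝ) (i j k l : Fin n) : Euc n → ℝ :=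
  fun x =>
    pd i (pd k (H j l)) x - pd i (pd l (H j k)) x - pd j (pd k (H i l)) x
      + pd j (pd l (H i k)) x
      + (1 / ((n : ℝ) - 2)) * (Aop H j l x * kd i k - Aop H j k x * kd i l
          - Aop H i l x * kd j k + Aop H i k x * kd j l)

/-- if `Z_{inkn} = 0` on `∂ℝ^n_+`, then the boundary quantity `Â_{ik}` equals
`((n-3)/(n-2)) A_{ik}` on `∂ℝ^n_+` for all tangential indices `i,k`. -/
theorem statement17 (n : ℕ) (hn : 6 ≤ n) (l₀ : Fin n) (hl₀ : (l₀ : ℕ) = n - 1)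
    (d : ℕ) (hd : d = (n - 2) / 2)
    (h : Fin n → Fin n → (Fin n → ℕ) → ℝ)
    (H : Fin n → Fin n → Euc n → ℝ)
    (hHdef : ∀ i k x, H i k x = ∑ α ∈ MIdx n d, h i k α * ∏ m, x m ^ α m)
    (hsymm : ∀ i k x, H i k x = H k i x)
    (htrace : ∀ x, ∑ i, H i i x = 0)
    (hH1 : ∀ x : Euc n, 0 ≤ x l₀ → ∀ i, H i l₀ x = 0)
    (hH2 : ∀ x : Euc n, x l₀ = 0 → ∀ i, ∑ k, H i k x * x k = 0)
    (hH3 : ∀ x : Euc n, x l₀ = 0 → ∀ i k, pd l₀ (H i k) x = 0)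
    (Ahat : Fin n → Fin n → Euc n → ℝ)
    (hAhat : ∀ i k x, Ahat i k x =
      (∑ m ∈ Finset.univ.erase l₀, pd i (pd m (H m k)) x)
        + (∑ m ∈ Finset.univ.erase l₀, pd m (pd k (H i m)) x)
        - (∑ m ∈ Finset.univ.erase l₀, pd m (pd m (H i k)) x)
        - (1 / ((n : ℝ) - 2)) * (∑ m, ∑ p, pd m (pd p (H m p)) x) * kd i k)
    (hZ : ∀ x : Euc n, x l₀ = 0 → ∀ i k, i ≠ l₀ → k ≠ l₀ → Zop H i l₀ k l₀ x = 0) :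
    ∀ x : Euc n, x l₀ = 0 → ∀ i k, i ≠ l₀ → k ≠ l₀ →
      Ahat i k x = (((n : ℝ) - 3) / ((n : ℝ) - 2)) * Aop H i k x := by
  have hn' : (6:ℝ) ≤ n := by exact_mod_cast hn
  have hz : ∀ i, H i l₀ = fun _ => 0 := by
    intro i
    have han : AnalyticOnNhd ℝ (H i l₀) Set.univ := by
      have : H i l₀ = fun x => ∑ α ∈ MIdx n d, h i l₀ α * ∏ m, x m ^ α m :=
        funext (hHdef i l₀)
      rw [this]
      intro x _
      refine Finset.analyticAt_fun_sum _ fun α _ => ?_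
      refine analyticAt_const.mul ?_
      refine Finset.analyticAt_fun_prod _ fun m _ => ?_
      refine AnalyticAt.pow ?_ _
      exact (EuclideanSpace.proj m : Euc n →L[ℝ] ℝ).analyticAt x
    have hcont : Continuous fun x : Euc n => x l₀ :=
      (EuclideanSpace.proj l₀ : Euc n →L[ℝ] ℝ).continuous
    refine han.eq_of_eventuallyEq (z₀ := EuclideanSpace.single l₀ 1)
      (fun _ _ => analyticAt_const) ?_
    have : {x : Euc n | 0 < x l₀} ∈ nhds (EuclideanSpace.single l₀ (1:ℝ)) :=
      (isOpen_lt continuous_const hcont).mem_nhds (by simp)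
    filter_upwards [this] with x hx
    exact hH1 x (le_of_lt hx) i
  have hz' : ∀ i, H l₀ i = fun _ => 0 := by
    intro i
    rw [← hz i]
    exact funext (hsymm l₀ i)
  have hpd : ∀ m : Fin n, pd m (fun _ : Euc n => (0:ℝ)) = fun _ => 0 := by
    intro m
    funext x
    simp [pd]
  intro x hx i k hi hk
  have hZ' := hZ x hx i k hi hk
  have e1 : Aop H l₀ l₀ x
      = - ((1 / ((n : ℝ) - 1)) * (∑ m, ∑ p, pd m (pd p (H m p)) x)) := by
    simp [Aop, hz, hz', hpd, kd]
  have k1 : kd i l₀ = 0 := if_neg hi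
  have k2 : kd l₀ k = 0 := if_neg (Ne.symm hk)
  have k3 : kd l₀ l₀ = 1 := if_pos rfl
  have s1 := Finset.add_sum_erase Finset.univ (fun m => pd i (pd m (H m k)) x) (Finset.mem_univ l₀)
  have s2 := Finset.add_sum_erase Finset.univ (fun m => pd m (pd k (H i m)) x) (Finset.mem_univ l₀)
  have s3 := Finset.add_sum_erase Finset.univ (fun m => pd m (pd m (H i k)) x) (Finset.mem_univ l₀)
  simp only [hz, hz', hpd, zero_add] at s1 s2 s3
  have eA : Aop H i k x = (∑ m, pd i (pd m (H m k)) x) + (∑ m, pd m (pd k (H i m)) x)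
      - (∑ m, pd m (pd m (H i k)) x)
      - (1 / ((n : ℝ) - 1)) * (∑ m, ∑ p, pd m (pd p (H m p)) x) * kd i k := rfl
  unfold Zop at hZ'
  rw [k1, k2, k3, e1] at hZ'
  simp only [hz, hz', hpd] at hZ'
  rw [hAhat, s1, s2]
  generalize (∑ m, ∑ p, pd m (pd p (H m p)) x) = D at *
  generalize Aop H i k x = A at *
  generalize kd i k = δ at *
  generalize pd l₀ (pd l₀ (H i k)) x = P at *
  have h1 : (n:ℝ) - 1 ≠ 0 := by linarith
  have h2 : (n:ℝ) - 2 ≠ 0 := by linarith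
  have hP : P = - ((1 / ((n : ℝ) - 2)) * (A - 1 / ((n:ℝ) - 1) * D * δ)) := by
    linear_combination hZ'
  have : ∀ S1 S2 S3 S3' : ℝ, P + S3' = S3 → A = S1 + S2 - S3 - 1 / ((n:ℝ) - 1) * D * δ →
      S1 + S2 - S3' - 1 / ((n:ℝ) - 2) * D * δ = ((n:ℝ) - 3) / ((n:ℝ) - 2) * A := by
    intro S1 S2 S3 S3' a b
    have c : S1 + S2 - S3' - 1 / ((n:ℝ) - 2) * D * δ
        = A + 1 / ((n:ℝ) - 1) * D * δ + P - 1 / ((n:ℝ) - 2) * D * δ := by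
      linear_combination -a - b
    rw [c, hP]
    field_simp
    ring
  exact this _ _ _ _ s3 eA
end
end
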